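/- arXiv:1807.08780 — 5 statements merged into one kernel-verified Lean document; each statement's English description precedes it below -/
import Mathlib

section
/- Let n : ℕ and let S be an additive submonoid of ℤⁿ (i.e. of Fin n → ℤ). Then S is finitely generated as an additive monoid if and only if the convex cone it generates in ℝⁿ is closed and rational polyhedral; concretely, S is finitely generated if and only if there exists a finite set T of points of ℤⁿ such that the ℝ≥0-span in ℝⁿ (Fin n → ℝ) of the image of T under the coordinatewise coercion ℤ → ℝ equals the ℝ≥0-span of the image of S. (Lemma 2.9 of the paper.) -/
open scoped NNReal

/-- The coordinatewise coercion `ℤⁿ → ℝⁿ`. -/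
noncomputable def latticeEmb (n : ℕ) : (Fin n → ℤ) → (Fin n → ℝ) :=
  fun v i => (v i : ℝ)

/-- Every element of the cone generated by a finite set `F` of lattice points differs from a
nonnegative integer combination of `F` by a lattice point of a fixed box. -/
theorem exists_nat_combination_sub_mem_Icc {n : ℕ} (F : Finset (Fin n → ℤ)) {s : Fin n → ℤ}
    (hs : latticeEmb n s ∈ Submodule.span ℝ≥0 (latticeEmb n '' (F : Set (Fin n → ℤ)))) :
    ∃ a : F → ℕ, s - ∑ f, a f • (f : Fin n → ℤ) ∈
      Set.Icc (-∑ f : F, |(f : Fin n → ℤ)|) (∑ f : F, |(f : Fin n → ℤ)|) := by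
  obtain ⟨c, hc⟩ := (Submodule.mem_span_image_finset_iff_exists_fun ℝ≥0).1 hs
  refine ⟨fun f => ⌊c f⌋₊, ?_⟩
  suffices h : ∀ i, |s i - ∑ f : F, (⌊c f⌋₊ : ℤ) * (f : Fin n → ℤ) i| ≤
      ∑ f : F, |(f : Fin n → ℤ) i| by
    constructor <;> intro i
    · simpa [Pi.abs_apply, Finset.sum_apply] using (abs_le.1 (h i)).1
    · simpa [Pi.abs_apply, Finset.sum_apply] using (abs_le.1 (h i)).2
  intro i
  have hi : ∑ f : F, (c f : ℝ) * ((f : Fin n → ℤ) i : ℝ) = s i := by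
    simpa [latticeEmb, NNReal.smul_def] using congrFun hc i
  have hrem : ((s i - ∑ f : F, (⌊c f⌋₊ : ℤ) * (f : Fin n → ℤ) i : ℤ) : ℝ) =
      ∑ f : F, ((c f : ℝ) - ⌊c f⌋₊) * ((f : Fin n → ℤ) i : ℝ) := by
    push_cast
    simp only [sub_mul, Finset.sum_sub_distrib, hi]
  rw [← Int.cast_le (R := ℝ), Int.cast_abs, hrem, Int.cast_sum]
  refine (Finset.abs_sum_le_sum_abs _ _).trans (Finset.sum_le_sum fun f _ => ?_)
  rw [abs_mul, Int.cast_abs]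
  refine mul_le_of_le_one_left (abs_nonneg _) ?_
  have hle : ((⌊c f⌋₊ : ℝ≥0) : ℝ) ≤ c f := NNReal.coe_le_coe.2 (Nat.floor_le zero_le)
  have hlt : (c f : ℝ) < ((⌊c f⌋₊ + 1 : ℝ≥0) : ℝ) := NNReal.coe_lt_coe.2 (Nat.lt_floor_add_one _)
  push_cast at hle hlt
  rw [abs_le]
  constructor <;> linarith

/-- **Dickson's lemma**: the minimal elements of a set form a finite dominating subset. -/
theorem exists_finite_subset_forall_exists_le {α : Type*} [PartialOrder α] [WellQuasiOrderedLE α]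
    (U : Set α) : ∃ A ⊆ U, A.Finite ∧ ∀ u ∈ U, ∃ a ∈ A, a ≤ u := by
  refine ⟨{a | Minimal (· ∈ U) a}, fun a ha => ha.prop,
    WellQuasiOrderedLE.finite_of_isAntichain (setOfPred_minimal_antichain _), fun u hu => ?_⟩
  obtain ⟨a, hau, ha⟩ := exists_minimal_le_of_wellFoundedLT (· ∈ U) u hu
  exact ⟨a, ha, hau⟩

/-- A submonoid of `ℤⁿ` lying in the cone generated by finitely many of its elements is
finitely generated. -/
theorem AddSubmonoid.fg_of_latticeEmb_mem_span {n : ℕ} (S : AddSubmonoid (Fin n → ℤ))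
    (F : Finset (Fin n → ℤ)) (hF : (F : Set (Fin n → ℤ)) ⊆ S)
    (hS : ∀ s ∈ S, latticeEmb n s ∈
      Submodule.span ℝ≥0 (latticeEmb n '' (F : Set (Fin n → ℤ)))) : S.FG := by
  set B : Fin n → ℤ := ∑ f : F, |(f : Fin n → ℤ)|
  let comb : (F → ℕ) → Fin n → ℤ := fun a => ∑ f, a f • (f : Fin n → ℤ)
  choose A hAU hAfin hAle using fun r : Fin n → ℤ =>
    exists_finite_subset_forall_exists_le {a : F → ℕ | r + comb a ∈ S}
  refine (AddSubmonoid.fg_iff S).2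
    ⟨F ∪ ⋃ r ∈ Set.Icc (-B) B, (fun a => r + comb a) '' A r, le_antisymm ?_ ?_, ?_⟩
  · rw [AddSubmonoid.closure_le]
    refine Set.union_subset hF (Set.iUnion₂_subset fun r _ => ?_)
    rintro _ ⟨a, ha, rfl⟩
    exact hAU r ha
  · intro s hs
    obtain ⟨u, hu⟩ := exists_nat_combination_sub_mem_Icc F (hS s hs)
    obtain ⟨a, ha, hau⟩ := hAle (s - comb u) u (by simpa using hs)
    have hsplit : s = (s - comb u + comb a) + comb (u - a) := by
      have : comb u = comb a + comb (u - a) := by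
        simp only [comb, ← Finset.sum_add_distrib, ← add_smul, Pi.sub_apply]
        exact Finset.sum_congr rfl fun f _ => by rw [Nat.add_sub_cancel' (hau f)]
      rw [this]
      abel
    rw [hsplit]
    refine add_mem (AddSubmonoid.subset_closure (Set.mem_union_right _ ?_))
      (AddSubmonoid.sum_mem _ fun f _ => AddSubmonoid.nsmul_mem _
        (AddSubmonoid.subset_closure (Set.mem_union_left _ f.2)) _)
    exact Set.mem_biUnion hu ⟨a, ha, rfl⟩
  · exact F.finite_toSet.union
      ((Set.finite_Icc _ _).biUnion fun r _ => (hAfin r).image _)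

/-- The cone over the submonoid generated by `T` is the cone over `T`. -/
theorem span_latticeEmb_image_closure {n : ℕ} (T : Set (Fin n → ℤ)) :
    Submodule.span ℝ≥0 (latticeEmb n '' (AddSubmonoid.closure T : Set (Fin n → ℤ))) =
      Submodule.span ℝ≥0 (latticeEmb n '' T) := by
  refine le_antisymm (Submodule.span_le.2 ?_)
    (Submodule.span_mono (Set.image_mono AddSubmonoid.subset_closure))
  rintro _ ⟨s, hs, rfl⟩
  induction hs using AddSubmonoid.closure_induction with
  | mem x hx => exact Submodule.subset_span ⟨x, hx, rfl⟩
  | zero =>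
    have h : latticeEmb n 0 = 0 := by
      ext i
      simp [latticeEmb]
    exact h ▸ zero_mem _
  | add x y _ _ hx hy =>
    have h : latticeEmb n (x + y) = latticeEmb n x + latticeEmb n y := by
      ext i
      simp [latticeEmb]
    exact h ▸ add_mem hx hy

/-- **Lemma 2.9.** A submonoid `S` of `ℤⁿ` is finitely generated if and only if the convex
cone it generates in `ℝⁿ` is closed and rational polyhedral, i.e. there is a finite set `T`
of lattice points whose `ℝ≥0`-span equals the `ℝ≥0`-span of `S`. -/
theorem submonoid_fg_iff_cone_rational_polyhedral (n : ℕ) (S : AddSubmonoid (Fin n → ℤ)) :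
    S.FG ↔ ∃ T : Finset (Fin n → ℤ),
      Submodule.span ℝ≥0 (latticeEmb n '' (T : Set (Fin n → ℤ))) =
        Submodule.span ℝ≥0 (latticeEmb n '' (S : Set (Fin n → ℤ))) := by
  classical
  constructor
  · rintro ⟨T, rfl⟩
    exact ⟨T, (span_latticeEmb_image_closure _).symm⟩
  · rintro ⟨T, hT⟩
    have hfg : (Submodule.span ℝ≥0 (latticeEmb n '' (S : Set (Fin n → ℤ)))).FG :=
      hT ▸ Submodule.fg_span (T.finite_toSet.image _)
    obtain ⟨G, hGS, hG⟩ := Submodule.fg_span_iff_fg_span_finset_subset _ |>.1 hfg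
    obtain ⟨F, hF, rfl⟩ := Finset.subset_set_image_iff.1 hGS
    rw [Finset.coe_image] at hG
    exact S.fg_of_latticeEmb_mem_span F hF fun s hs => hG ▸ Submodule.subset_span ⟨s, hs, rfl⟩
end

section
/- In the setting of the context, let ν be a fully homogeneous valuation on R and assume the valuation cone C(R, ν) is rational polyhedral, i.e. it equals the ℝ≥0-span of the images of finitely many points of ℤᵐ × ℤⁿ. Then the value semigroup S(R, ν) is finitely generated if and only if for every nonzero v = (v₁, v₂) ∈ ℤᵐ × ℤⁿ whose nonnegative real ray ℝ≥0·v̄ (v̄ the image of v in ℝᵐ × ℝⁿ) is contained in C(R, ν), the value semigroup S(R(ray(v₁)), ν) of the Veronese subalgebra R(ray(v₁)) is finitely generated and C(R(ray(v₁)), ν) = C(R, ν) ∩ π⁻¹(ℝ≥0·v̄₁), where v̄₁ is the image of v₁ in ℝᵐ. (Theorem 3.3 / Theorem 1.1 of the paper, equivalence of conditions (1) and (2).) -/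
open scoped NNReal

noncomputable section

/-- The coordinatewise embedding of `Γ = ℤᵐ × ℤⁿ` into `ℝᵐ × ℝⁿ`. -/
def embG (m n : ℕ) : (Fin m → ℤ) × (Fin n → ℤ) → (Fin m → ℝ) × (Fin n → ℝ) :=
  fun v => (fun i => ((v.1 i : ℤ) : ℝ), fun j => ((v.2 j : ℤ) : ℝ))

/-- The coordinatewise embedding of `ℤᵐ` into `ℝᵐ`. -/
def embM (m : ℕ) : (Fin m → ℤ) → (Fin m → ℝ) := fun u i => ((u i : ℤ) : ℝ)

/-- The set of lattice points `u ∈ ℤᵐ` lying on the nonnegative rational ray through `v`,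
i.e. `u = q • v` in `ℚᵐ` for some rational `q ≥ 0`. -/
def rayZ {m : ℕ} (v : Fin m → ℤ) : Set (Fin m → ℤ) :=
  {u | ∃ q : ℚ, 0 ≤ q ∧ ∀ i, ((u i : ℤ) : ℚ) = q * ((v i : ℤ) : ℚ)}

variable {K R : Type} [Field K] [IsAlgClosed K] [CommRing R] [IsDomain R] [Algebra K R]
variable {m n : ℕ}

/-- The value semigroup `ν(A \ {0})` of a valuation on the subset `A ⊆ R`
(as an additive submonoid of `Γ`). -/
def valueSemigroup (ν : R → (Fin m → ℤ) × (Fin n → ℤ)) (A : Set R) :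
    AddSubmonoid ((Fin m → ℤ) × (Fin n → ℤ)) :=
  AddSubmonoid.closure (ν '' {f | f ∈ A ∧ f ≠ 0})

/-- The valuation cone: the topological closure in `ℝᵐ × ℝⁿ` of the `ℝ≥0`-span of the image
of the value semigroup. -/
def valuationCone (ν : R → (Fin m → ℤ) × (Fin n → ℤ)) (A : Set R) :
    Set ((Fin m → ℝ) × (Fin n → ℝ)) :=
  closure (Submodule.span ℝ≥0 (embG m n '' (valueSemigroup ν A : Set _)) : Set _)

/-- The Veronese subalgebra `R(U)` associated to a set of degrees `U ⊆ ℤᵐ`. -/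
def veronese (𝒜 : (Fin m → ℤ) → Submodule K R) (U : Set (Fin m → ℤ)) : Subalgebra K R :=
  Algebra.adjoin K (⋃ u ∈ U, (𝒜 u : Set R))

/-- Cones spanned by finite subfamilies of a finite family are closed: by induction, either the
subfamily is linearly independent, or the cone is a union of cones of smaller subfamilies. -/
lemma isClosed_finset_cone {ι E : Type*} [DecidableEq ι] [NormedAddCommGroup E] [NormedSpace ℝ E]
    (s : ι → E) (I : Finset ι) :
    IsClosed {x | ∃ a : ι → ℝ, (∀ i, 0 ≤ a i) ∧ ∑ i ∈ I, a i • s i = x} := by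
  induction I using Finset.strongInduction with
  | H I ih =>
  by_cases hI : LinearIndependent ℝ (fun i : I => s i)
  · have hker : LinearMap.ker (Fintype.linearCombination ℝ (fun i : I => s i)) = ⊥ :=
      LinearMap.ker_eq_bot.mpr (hI.fintypeLinearCombination_injective)
    have hemb := LinearMap.isClosedEmbedding_of_injective hker
    have hpos : IsClosed {a : I → ℝ | ∀ i, 0 ≤ a i} := by
      simp only [Set.ofPred_forall]
      exact isClosed_iInter fun i => isClosed_le continuous_const (continuous_apply i)
    convert hemb.isClosedMap _ hpos using 1
    ext x
    simp only [Set.mem_ofPred_eq, Set.mem_image, Fintype.linearCombination_apply]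
    constructor
    · rintro ⟨a, ha, rfl⟩
      exact ⟨fun i => a i, fun i => ha i, Finset.sum_coe_sort I (fun i => a i • s i)⟩
    · rintro ⟨a, ha, rfl⟩
      refine ⟨fun i => if h : i ∈ I then a ⟨i, h⟩ else 0, fun i => ?_, ?_⟩
      · dsimp only
        split_ifs
        exacts [ha _, le_rfl]
      · rw [← Finset.sum_coe_sort I]
        exact Finset.sum_congr rfl fun i _ => by simp
  · obtain ⟨g, hg, i₁, hi₁⟩ : ∃ g : ι → ℝ, ∑ i ∈ I, g i • s i = 0 ∧ ∃ i ∈ I, 0 < g i := by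
      obtain ⟨g, hg, i, hi⟩ := Fintype.not_linearIndependent_iff.mp hI
      have hext : ∑ j ∈ I, (if h : j ∈ I then g ⟨j, h⟩ else 0) • s j = 0 := by
        rw [← hg, ← Finset.sum_coe_sort I]
        exact Finset.sum_congr rfl fun i _ => by simp
      rcases lt_or_gt_of_ne hi with h | h
      · refine ⟨fun j => -(if h : j ∈ I then g ⟨j, h⟩ else 0), ?_, i, i.2, ?_⟩
        · simp only [neg_smul, Finset.sum_neg_distrib, hext, neg_zero]
        · simpa using h
      · exact ⟨_, hext, i, i.2, by simpa using h⟩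
    have hunion : {x | ∃ a : ι → ℝ, (∀ i, 0 ≤ a i) ∧ ∑ i ∈ I, a i • s i = x} =
        ⋃ j ∈ I, {x | ∃ a : ι → ℝ, (∀ i, 0 ≤ a i) ∧ ∑ i ∈ I.erase j, a i • s i = x} := by
      ext x
      simp only [Set.mem_ofPred_eq, Set.mem_iUnion]
      constructor
      · rintro ⟨a, ha, rfl⟩
        obtain ⟨j, hj, hmin⟩ := Finset.exists_min_image (I.filter fun i => 0 < g i)
          (fun i => a i / g i) ⟨i₁, by simpa using hi₁⟩
        simp only [Finset.mem_filter, and_imp] at hj hmin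
        have hr : 0 ≤ a j / g j := div_nonneg (ha j) hj.2.le
        have key : ∀ i ∈ I, 0 ≤ a i - a j / g j * g i := by
          intro i hi
          rcases le_or_gt (g i) 0 with h | h
          · nlinarith [ha i, mul_nonneg hr (neg_nonneg.mpr h)]
          · have := (le_div_iff₀ h).mp (hmin i hi h)
            linarith
        refine ⟨j, hj.1, fun i => if i ∈ I then a i - a j / g j * g i else 0, fun i => ?_, ?_⟩
        · dsimp only
          split_ifs with h
          exacts [key i h, le_rfl]
        · have hzero : (if j ∈ I then a j - a j / g j * g j else 0) • s j = 0 := by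
            rw [if_pos hj.1, div_mul_cancel₀ _ hj.2.ne', sub_self, zero_smul]
          rw [Finset.sum_erase I hzero]
          calc _ = ∑ i ∈ I, (a i • s i - (a j / g j) • g i • s i) :=
                Finset.sum_congr rfl fun i hi => by simp only [if_pos hi, sub_smul, mul_smul]
            _ = _ := by rw [Finset.sum_sub_distrib, ← Finset.smul_sum, hg, smul_zero, sub_zero]
      · rintro ⟨j, hj, a, ha, rfl⟩
        refine ⟨fun i => if i = j then 0 else a i, fun i => ?_, ?_⟩
        · dsimp only
          split_ifs
          exacts [le_rfl, ha i]
        · rw [← Finset.sum_erase I (a := j) (by simp)]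
          exact Finset.sum_congr rfl fun i hi => by simp only [if_neg (Finset.ne_of_mem_erase hi)]
    rw [hunion]
    exact I.finite_toSet.isClosed_biUnion fun j hj => ih _ (Finset.erase_ssubset hj)

lemma mem_span_nnreal_range_iff {ι E : Type*} [Fintype ι] [AddCommGroup E] [Module ℝ E]
    (s : ι → E) (x : E) :
    x ∈ Submodule.span ℝ≥0 (Set.range s) ↔
      ∃ a : ι → ℝ, (∀ i, 0 ≤ a i) ∧ ∑ i, a i • s i = x := by
  rw [Submodule.mem_span_range_iff_exists_fun]
  constructor
  · rintro ⟨c, rfl⟩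
    exact ⟨fun i => c i, fun i => (c i).2, rfl⟩
  · rintro ⟨a, ha, rfl⟩
    exact ⟨fun i => ⟨a i, ha i⟩, rfl⟩

lemma isClosed_span_nnreal_range {ι E : Type*} [Fintype ι] [NormedAddCommGroup E]
    [NormedSpace ℝ E] (s : ι → E) :
    IsClosed (Submodule.span ℝ≥0 (Set.range s) : Set E) := by
  classical
  convert isClosed_finset_cone s Finset.univ using 1
  ext x
  exact mem_span_nnreal_range_iff s x

/-- A nonnegative real vector is a limit of nonnegative rational vectors which satisfy all the
rational linear relations it satisfies and are positive wherever it is. -/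
lemma mem_closure_rational_relations {ι : Type*} [Fintype ι] (x : ι → ℝ) (hx : ∀ i, 0 ≤ x i) :
    x ∈ closure {y : ι → ℝ | ∃ N : ℕ, 0 < N ∧ ∃ k : ι → ℕ, (∀ i, 0 < x i → 0 < k i) ∧
      (∀ c : ι → ℤ, ∑ i, (c i : ℝ) * x i = 0 → ∑ i, c i * (k i : ℤ) = 0) ∧
      y = fun i => (N : ℝ)⁻¹ * k i} := by
  have hfin : FiniteDimensional ℚ (Submodule.span ℚ (Set.range x)) :=
    FiniteDimensional.span_of_finite ℚ (Set.finite_range x)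
  let d := Module.finrank ℚ (Submodule.span ℚ (Set.range x))
  let b : Module.Basis (Fin d) ℚ _ := Module.finBasis ℚ (Submodule.span ℚ (Set.range x))
  let X : ι → Submodule.span ℚ (Set.range x) := fun i => ⟨x i, Submodule.subset_span ⟨i, rfl⟩⟩
  let M : ι → Fin d → ℚ := fun i j => b.repr (X i) j
  let Φ : (Fin d → ℝ) → (ι → ℝ) := fun q i => ∑ j, (M i j : ℝ) * q j
  have hΦ : Continuous Φ := by fun_prop
  have hΦx : Φ (fun j => (b j : ℝ)) = x := by
    funext i
    have := congrArg (Subtype.val) (b.sum_repr (X i))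
    rw [AddSubmonoidClass.coe_finsetSum] at this
    simpa only [Φ, Submodule.coe_smul, Rat.smul_def] using this
  have hopen : IsOpen {q | ∀ i, 0 < x i → 0 < Φ q i} := by
    simp only [Set.ofPred_forall]
    exact isOpen_iInter_of_finite fun i => isOpen_iInter_of_finite fun _ =>
      isOpen_lt continuous_const ((continuous_apply i).comp hΦ)
  have hdense : DenseRange (Pi.map fun (_ : Fin d) (r : ℚ) => (r : ℝ)) :=
    DenseRange.piMap fun _ => Rat.denseRange_cast
  have hmem := hdense.open_subset_closure_inter hopen
    (show (fun j => (b j : ℝ)) ∈ _ from fun i hi => by rw [hΦx]; exact hi)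
  refine Set.mem_of_eq_of_mem hΦx.symm (map_mem_closure hΦ hmem ?_)
  rintro _ ⟨hpos, r, rfl⟩
  let y : ι → ℚ := fun i => ∑ j, M i j * r j
  have hy : ∀ i, Φ (Pi.map (fun _ (r : ℚ) => (r : ℝ)) r) i = y i := fun i => by simp [Φ, y]
  have hypos : ∀ i, 0 < x i → 0 < y i := fun i hi => by
    have := hpos i hi
    rw [hy] at this
    exact_mod_cast this
  have hynonneg : ∀ i, 0 ≤ y i := by
    intro i
    rcases (hx i).eq_or_lt with h | h
    · have hX : X i = 0 := Subtype.ext h.symm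
      simp [y, M, hX]
    · exact (hypos i h).le
  have hyrel : ∀ c : ι → ℤ, ∑ i, (c i : ℝ) * x i = 0 → ∑ i, (c i : ℚ) * y i = 0 := by
    intro c hc
    have hX : ∑ i, (c i : ℚ) • X i = 0 := by
      apply Subtype.ext
      simpa [X, Rat.smul_def] using hc
    have hM : ∀ j, ∑ i, (c i : ℚ) * M i j = 0 := by
      intro j
      have := congrArg (fun z => b.repr z j) hX
      simpa [M] using this
    simp only [y, Finset.mul_sum]
    rw [Finset.sum_comm]
    refine Finset.sum_eq_zero fun j _ => ?_
    simp only [← mul_assoc, ← Finset.sum_mul, hM, zero_mul]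
  obtain ⟨N, hN, hNy⟩ : ∃ N : ℕ, 0 < N ∧ ∀ i, ∃ k : ℕ, (k : ℚ) = N * y i := by
    refine ⟨∏ i, (y i).den, Finset.prod_pos fun i _ => (y i).den_pos, fun i => ?_⟩
    obtain ⟨e, he⟩ := Finset.dvd_prod_of_mem (fun i => (y i).den) (Finset.mem_univ i)
    refine ⟨(y i).num.toNat * e, ?_⟩
    have hnum : (((y i).num.toNat : ℕ) : ℚ) = (y i).num := by
      exact_mod_cast Int.toNat_of_nonneg (Rat.num_nonneg.mpr (hynonneg i))
    rw [he]
    push_cast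
    rw [hnum, ← Rat.mul_den_eq_num (y i)]
    ring
  choose k hk using hNy
  refine ⟨N, hN, k, fun i hi => ?_, fun c hc => ?_, ?_⟩
  · have : (0 : ℚ) < k i := by
      rw [hk]
      exact mul_pos (by exact_mod_cast hN) (hypos i hi)
    exact_mod_cast this
  · have : ∑ i, (c i : ℚ) * k i = 0 := by
      simp only [hk, mul_left_comm _ (N : ℚ), ← Finset.mul_sum, hyrel c hc, mul_zero]
    exact_mod_cast this
  · funext i
    have h : ((k i : ℕ) : ℝ) = N * y i := by exact_mod_cast hk i
    have hN' : (N : ℝ) ≠ 0 := by exact_mod_cast hN.ne'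
    rw [hy, h, inv_mul_cancel_left₀ hN']

lemma embG_add (u v : (Fin m → ℤ) × (Fin n → ℤ)) :
    embG m n (u + v) = embG m n u + embG m n v := by
  ext <;> simp [embG]

lemma embG_zero : embG m n 0 = 0 := by
  ext <;> simp [embG]

/-- `embG` as a homomorphism of additive groups. -/
def embGHom (m n : ℕ) : (Fin m → ℤ) × (Fin n → ℤ) →+ (Fin m → ℝ) × (Fin n → ℝ) where
  toFun := embG m n
  map_zero' := embG_zero
  map_add' := embG_add

lemma embG_nsmul (k : ℕ) (v : (Fin m → ℤ) × (Fin n → ℤ)) :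
    embG m n (k • v) = (k : ℝ) • embG m n v :=
  (map_nsmul (embGHom m n) k v).trans (Nat.cast_smul_eq_nsmul ℝ k _).symm

lemma embG_sum_nsmul {ι : Type*} (s : Finset ι) (k : ι → ℕ)
    (g : ι → (Fin m → ℤ) × (Fin n → ℤ)) :
    embG m n (∑ i ∈ s, k i • g i) = ∑ i ∈ s, (k i : ℝ) • embG m n (g i) :=
  (map_sum (embGHom m n) _ s).trans (Finset.sum_congr rfl fun i _ => embG_nsmul (k i) (g i))

/-- The real cone spanned by a submonoid is spanned by any generating set of the submonoid. -/
lemma span_embG_closure (s : Set ((Fin m → ℤ) × (Fin n → ℤ))) :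
    Submodule.span ℝ≥0 (embG m n '' (AddSubmonoid.closure s : Set _)) =
      Submodule.span ℝ≥0 (embG m n '' s) := by
  apply le_antisymm
  · rw [Submodule.span_le]
    rintro _ ⟨v, hv, rfl⟩
    induction hv using AddSubmonoid.closure_induction with
    | mem x hx => exact Submodule.subset_span ⟨x, hx, rfl⟩
    | zero => rw [embG_zero]; exact zero_mem _
    | add x y _ _ hx hy => rw [embG_add]; exact add_mem hx hy
  · exact Submodule.span_mono (Set.image_mono AddSubmonoid.subset_closure)

/-- An integral point in the real cone of a finite family of integral points has a positive
multiple in the submonoid generated by the family. -/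
lemma exists_nsmul_eq_sum_of_cone {ι : Type*} [Fintype ι]
    (g : ι → (Fin m → ℤ) × (Fin n → ℤ)) (v : (Fin m → ℤ) × (Fin n → ℤ)) (a : ι → ℝ)
    (ha : ∀ i, 0 ≤ a i) (hv : ∑ i, a i • embG m n (g i) = embG m n v) :
    ∃ k : ℕ, 0 < k ∧ ∃ l : ι → ℕ, k • v = ∑ i, l i • g i := by
  let x : Option ι → ℝ := fun o => o.elim 1 a
  have hx : ∀ o, 0 ≤ x o := by
    rintro (_ | i)
    exacts [zero_le_one, ha i]
  obtain ⟨_, N, -, k, hpos, hrel, -⟩ :=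
    closure_nonempty_iff.mp ⟨x, mem_closure_rational_relations x hx⟩
  refine ⟨k none, hpos none zero_lt_one, fun i => k (some i), ?_⟩
  have h₁ := congrArg Prod.fst hv
  have h₂ := congrArg Prod.snd hv
  ext p
  · have := hrel (fun o => o.elim (v.1 p) fun i => -(g i).1 p) (by
      have := congrFun h₁ p
      simp [-CharP.cast_eq_zero, Prod.fst_sum, embG] at this
      simp [-CharP.cast_eq_zero, x, ← this, mul_comm])
    simp [-CharP.cast_eq_zero, Prod.fst_sum, mul_comm] at this ⊢
    linarith
  · have := hrel (fun o => o.elim (v.2 p) fun i => -(g i).2 p) (by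
      have := congrFun h₂ p
      simp [-CharP.cast_eq_zero, Prod.snd_sum, embG] at this
      simp [-CharP.cast_eq_zero, x, ← this, mul_comm])
    simp [-CharP.cast_eq_zero, Prod.snd_sum, mul_comm] at this ⊢
    linarith

/-- The part of a finitely generated rational cone lying over a rational ray is the closure of the
cone spanned by the integral points of the submonoid over that ray. -/
lemma mem_closure_span_of_fst_mem_ray {ι : Type*} [Fintype ι]
    (g : ι → (Fin m → ℤ) × (Fin n → ℤ)) (w : Fin m → ℤ) (a : ι → ℝ) (ha : ∀ i, 0 ≤ a i)
    (c : ℝ) (hc : 0 ≤ c) (hw : (∑ i, a i • embG m n (g i)).1 = c • embM m w) :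
    ∑ i, a i • embG m n (g i) ∈ closure (Submodule.span ℝ≥0 (embG m n ''
      {s | s ∈ AddSubmonoid.closure (Set.range g) ∧ s.1 ∈ rayZ w}) : Set _) := by
  let x : Option ι → ℝ := fun o => o.elim c a
  have hx : ∀ o, 0 ≤ x o := by
    rintro (_ | i)
    exacts [hc, ha i]
  let Φ : (Option ι → ℝ) → (Fin m → ℝ) × (Fin n → ℝ) := fun y => ∑ i, y (some i) • embG m n (g i)
  have hΦ : Continuous Φ := by fun_prop
  refine map_mem_closure (f := Φ) hΦ (mem_closure_rational_relations x hx) ?_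
  rintro _ ⟨N, -, k, -, hrel, rfl⟩
  have hsum : Φ (fun o => (N : ℝ)⁻¹ * k o) =
      (N : ℝ≥0)⁻¹ • embG m n (∑ i, k (some i) • g i) := by
    rw [embG_sum_nsmul, NNReal.smul_def, Finset.smul_sum]
    simp [-CharP.cast_eq_zero, Φ, mul_smul]
  rw [hsum]
  refine Submodule.smul_mem _ _ (Submodule.subset_span ⟨_, ⟨?_, ?_⟩, rfl⟩)
  · exact sum_mem fun i _ => nsmul_mem (AddSubmonoid.subset_closure (Set.mem_range_self i)) _
  · refine ⟨k none, Nat.cast_nonneg _, fun p => ?_⟩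
    have := hrel (fun o => o.elim (w p) fun i => -(g i).1 p) (by
      have := congrFun hw p
      simp [-CharP.cast_eq_zero, Prod.fst_sum, embG, embM] at this
      simp [-CharP.cast_eq_zero, x, mul_comm, this])
    simp [-CharP.cast_eq_zero, Prod.fst_sum, mul_comm] at this ⊢
    have h' : ∑ i, k (some i) * (g i).1 p = w p * k none := by linarith
    exact_mod_cast h'

lemma zero_mem_rayZ (v : Fin m → ℤ) : (0 : Fin m → ℤ) ∈ rayZ v :=
  ⟨0, le_rfl, fun i => by simp⟩

lemma add_mem_rayZ {v u w : Fin m → ℤ} (hu : u ∈ rayZ v) (hw : w ∈ rayZ v) : u + w ∈ rayZ v := by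
  obtain ⟨q, hq, hu⟩ := hu
  obtain ⟨r, hr, hw⟩ := hw
  exact ⟨q + r, add_nonneg hq hr, fun i => by simp [-CharP.cast_eq_zero, hu, hw, add_mul]⟩

/-- Membership in a rational ray, expressed with a uniform denominator. -/
lemma exists_mem_rayZ_iff (v : Fin m → ℤ) :
    ∃ d : ℕ, ∀ u, u ∈ rayZ v ↔ ∃ t : ℕ, d • u = t • v := by
  by_cases hv : v = 0
  · refine ⟨1, fun u => ?_⟩
    subst hv
    simp only [rayZ, Set.mem_ofPred_eq, one_nsmul, smul_zero, exists_const, funext_iff]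
    constructor
    · rintro ⟨q, -, h⟩ i
      simpa using h i
    · exact fun h => ⟨0, le_rfl, fun i => by simp [-CharP.cast_eq_zero, h i]⟩
  · obtain ⟨j, hj⟩ := Function.ne_iff.mp hv
    have hj : v j ≠ 0 := hj
    refine ⟨(v j).natAbs, fun u => ⟨?_, ?_⟩⟩
    · rintro ⟨q, hq, h⟩
      refine ⟨(u j).natAbs, funext fun i => ?_⟩
      have h' : (|(v j : ℚ)|) * u i = |(u j : ℚ)| * v i := by
        rw [h i, h j, abs_mul, abs_of_nonneg hq]
        ring
      simp only [Pi.smul_apply, nsmul_eq_mul, Int.natCast_natAbs]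
      exact_mod_cast h'
    · rintro ⟨t, ht⟩
      have hpos : (0 : ℚ) < |(v j : ℚ)| := by positivity
      refine ⟨t / |(v j : ℚ)|, by positivity, fun i => ?_⟩
      have h' := congrFun ht i
      simp only [Pi.smul_apply, nsmul_eq_mul, Int.natCast_natAbs] at h'
      have h'' : |(v j : ℚ)| * u i = t * v i := by exact_mod_cast h'
      field_simp
      linarith

/-- The part of a finitely generated submonoid over a rational ray is finitely generated. -/
lemma fg_of_mem_iff_fst_mem_rayZ {S P : AddSubmonoid ((Fin m → ℤ) × (Fin n → ℤ))} (hS : S.FG)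
    (v : Fin m → ℤ) (hP : ∀ s, s ∈ P ↔ s ∈ S ∧ s.1 ∈ rayZ v) : P.FG := by
  obtain ⟨G, rfl⟩ := hS
  obtain ⟨d, hd⟩ := exists_mem_rayZ_iff v
  let φ : (Option G → ℕ) →+ (Fin m → ℤ) × (Fin n → ℤ) :=
    { toFun := fun k => ∑ i : G, k (some i) • (i : (Fin m → ℤ) × (Fin n → ℤ))
      map_zero' := by simp
      map_add' := fun k l => by simp [-CharP.cast_eq_zero, add_smul, Finset.sum_add_distrib] }
  let ψ : (Option G → ℕ) →+ (Fin m → ℤ) :=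
    (nsmulAddMonoidHom d).comp ((AddMonoidHom.fst _ _).comp φ)
  let χ : (Option G → ℕ) →+ (Fin m → ℤ) :=
    { toFun := fun k => k none • v
      map_zero' := by simp
      map_add' := fun k l => by simp [-CharP.cast_eq_zero, add_smul] }
  have hfg := (AddSubmonoid.fg_eqLocusM ψ χ).map φ
  convert hfg using 1
  ext s
  rw [hP, hd, AddSubmonoid.mem_map]
  constructor
  · rintro ⟨hs, t, ht⟩
    obtain ⟨l, -, rfl⟩ := AddSubmonoid.mem_closure_finset.mp hs
    have hφ : φ (fun o => o.elim t fun i => l i) = ∑ i ∈ G, l i • i :=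
      Finset.sum_coe_sort G fun i => l i • i
    refine ⟨fun o => o.elim t fun i => l i, ?_, hφ⟩
    change d • (φ _).1 = t • v
    rw [hφ, ht]
  · rintro ⟨k, hk, rfl⟩
    exact ⟨sum_mem fun i _ => nsmul_mem (AddSubmonoid.subset_closure i.2) _, k none, hk⟩

/-- A submonoid of a lattice which contains integral generators of a real cone containing it is
finitely generated. -/
lemma fg_of_subset_cone {ι : Type*} [Fintype ι] (S : AddSubmonoid ((Fin m → ℤ) × (Fin n → ℤ)))
    (g : ι → (Fin m → ℤ) × (Fin n → ℤ)) (hg : ∀ i, g i ∈ S)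
    (hS : ∀ s ∈ S, ∃ a : ι → ℝ, (∀ i, 0 ≤ a i) ∧ ∑ i, a i • embG m n (g i) = embG m n s) :
    S.FG := by
  classical
  let B : (Fin m → ℤ) × (Fin n → ℤ) := (fun p => ∑ i, |(g i).1 p|, fun p => ∑ i, |(g i).2 p|)
  let P : (Fin m → ℤ) × (Fin n → ℤ) → Set (ι → ℕ) := fun r => {k | r + ∑ i, k i • g i ∈ S}
  let D : Set ((Fin m → ℤ) × (Fin n → ℤ)) := ⋃ r ∈ Set.Icc (-B) B,
    (fun k : ι → ℕ => r + ∑ i, k i • g i) '' {k | Minimal (· ∈ P r) k}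
  have hD : D.Finite := by
    refine (Set.finite_Icc _ _).biUnion fun r _ => Set.Finite.image _ ?_
    exact (setOfPred_minimal_antichain _).finite_of_partiallyWellOrderedOn
      ((Set.isPWO_of_wellQuasiOrderedLE (P r)).mono (setOfPred_minimal_subset _))
  rw [AddSubmonoid.fg_iff]
  refine ⟨D ∪ Set.range g, le_antisymm ?_ ?_, hD.union (Set.finite_range g)⟩
  · rw [AddSubmonoid.closure_le]
    rintro s (hs | ⟨i, rfl⟩)
    · simp only [D, Set.mem_iUnion] at hs
      obtain ⟨r, -, k, hk, rfl⟩ := hs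
      exact hk.1
    · exact hg i
  · intro s hs
    obtain ⟨a, ha, has⟩ := hS s hs
    let r := s - ∑ i, ⌊a i⌋₊ • g i
    have hr : r ∈ Set.Icc (-B) B := by
      have hcoord : ∀ (c : ι → ℤ) (t : ℤ), ∑ i, a i * c i = (t : ℝ) →
          |t - ∑ i, (⌊a i⌋₊ : ℤ) * c i| ≤ ∑ i, |c i| := by
        intro c t ht
        have hsub : ((t - ∑ i, (⌊a i⌋₊ : ℤ) * c i : ℤ) : ℝ) =
            ∑ i, (a i - ⌊a i⌋₊) * (c i : ℝ) := by
          push_cast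
          simp only [sub_mul, Finset.sum_sub_distrib, ht]
        have hle : |((t - ∑ i, (⌊a i⌋₊ : ℤ) * c i : ℤ) : ℝ)| ≤ ∑ i, |(c i : ℝ)| := by
          rw [hsub]
          refine (Finset.abs_sum_le_sum_abs _ _).trans (Finset.sum_le_sum fun i _ => ?_)
          rw [abs_mul]
          refine mul_le_of_le_one_left (abs_nonneg _) (abs_le.mpr ⟨?_, ?_⟩)
          · linarith [Nat.floor_le (ha i)]
          · linarith [Nat.lt_floor_add_one (a i)]
        exact_mod_cast hle
      have h₁ : ∀ p, |r.1 p| ≤ B.1 p := fun p => by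
        have := hcoord (fun i => (g i).1 p) (s.1 p) (by
          simpa [-CharP.cast_eq_zero, Prod.fst_sum, embG] using congrFun (congrArg Prod.fst has) p)
        simpa [-CharP.cast_eq_zero, r, B, Prod.fst_sum] using this
      have h₂ : ∀ p, |r.2 p| ≤ B.2 p := fun p => by
        have := hcoord (fun i => (g i).2 p) (s.2 p) (by
          simpa [-CharP.cast_eq_zero, Prod.snd_sum, embG] using congrFun (congrArg Prod.snd has) p)
        simpa [-CharP.cast_eq_zero, r, B, Prod.snd_sum] using this
      exact ⟨⟨fun p => (abs_le.mp (h₁ p)).1, fun p => (abs_le.mp (h₂ p)).1⟩,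
        ⟨fun p => (abs_le.mp (h₁ p)).2, fun p => (abs_le.mp (h₂ p)).2⟩⟩
    have hk : (fun i => ⌊a i⌋₊) ∈ P r := by
      simpa [-CharP.cast_eq_zero, P, r] using hs
    obtain ⟨z, hz, hzmin⟩ := (Set.isPWO_of_wellQuasiOrderedLE (P r)).exists_le_minimal hk
    obtain ⟨y, hy⟩ := exists_add_of_le hz
    have hs' : s = (r + ∑ i, z i • g i) + ∑ i, y i • g i := by
      have hfl : ∀ i, ⌊a i⌋₊ = z i + y i := congrFun hy
      rw [add_assoc, ← Finset.sum_add_distrib]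
      simp only [r, hfl, add_smul, sub_add_cancel]
    rw [hs']
    refine add_mem (AddSubmonoid.subset_closure (Or.inl ?_)) (sum_mem fun i _ => ?_)
    · exact Set.mem_biUnion hr ⟨z, hzmin, rfl⟩
    · have hi : g i ∈ D ∪ Set.range g := Or.inr (Set.mem_range_self i)
      exact nsmul_mem (AddSubmonoid.subset_closure hi) _

lemma exists_eq_of_mem_valueSemigroup (ν : R → (Fin m → ℤ) × (Fin n → ℤ))
    (hmul : ∀ f g : R, f ≠ 0 → g ≠ 0 → ν (f * g) = ν f + ν g)
    (hconst : ∀ c : K, c ≠ 0 → ν (algebraMap K R c) = 0) (A : Subalgebra K R)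
    {s : (Fin m → ℤ) × (Fin n → ℤ)} (hs : s ∈ valueSemigroup ν (A : Set R)) :
    ∃ f ∈ A, f ≠ 0 ∧ ν f = s := by
  induction hs using AddSubmonoid.closure_induction with
  | mem x hx =>
    obtain ⟨f, ⟨hf, hf0⟩, rfl⟩ := hx
    exact ⟨f, hf, hf0, rfl⟩
  | zero =>
    refine ⟨1, one_mem A, one_ne_zero, ?_⟩
    simpa using hconst 1 one_ne_zero
  | add x y _ _ hx hy =>
    obtain ⟨f, hf, hf0, rfl⟩ := hx
    obtain ⟨g, hg, hg0, rfl⟩ := hy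
    exact ⟨f * g, mul_mem hf hg, mul_ne_zero hf0 hg0, hmul f g hf0 hg0⟩

/-- The homogeneous components of elements of the Veronese subalgebra of an additively closed set
of degrees have degrees in that set. -/
lemma mem_of_decompose_ne_zero_of_mem_veronese (𝒜 : (Fin m → ℤ) → Submodule K R) [GradedAlgebra 𝒜]
    {U : Set (Fin m → ℤ)} (hU₀ : 0 ∈ U) (hU : ∀ u ∈ U, ∀ w ∈ U, u + w ∈ U) {f : R}
    (hf : f ∈ veronese 𝒜 U) (u : Fin m → ℤ)
    (hu : ((DirectSum.decompose 𝒜 f u : 𝒜 u) : R) ≠ 0) : u ∈ U := by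
  classical
  induction hf using Algebra.adjoin_induction generalizing u with
  | mem x hx =>
    simp only [Set.mem_iUnion] at hx
    obtain ⟨w, hw, hx⟩ := hx
    by_contra h
    exact hu (DirectSum.decompose_of_mem_ne 𝒜 hx fun h' => h (h' ▸ hw))
  | algebraMap r =>
    by_contra h
    exact hu (DirectSum.decompose_of_mem_ne 𝒜 (SetLike.algebraMap_mem_graded 𝒜 r)
      fun h' => h (h' ▸ hU₀))
  | add x y _ _ hx hy =>
    by_cases h : ((DirectSum.decompose 𝒜 x u : 𝒜 u) : R) = 0
    · refine hy u fun h' => hu ?_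
      rw [DirectSum.decompose_add, DirectSum.add_apply, Submodule.coe_add, h, h', add_zero]
    · exact hx u h
  | mul x y _ _ hx hy =>
    rw [DirectSum.decompose_mul, DirectSum.coe_mul_apply] at hu
    obtain ⟨⟨i, j⟩, hij, hne⟩ := Finset.exists_ne_zero_of_sum_ne_zero hu
    rw [← (Finset.mem_filter.mp hij).2]
    exact hU _ (hx i (left_ne_zero_of_mul hne)) _ (hy j (right_ne_zero_of_mul hne))

/-- The value semigroup of the Veronese subalgebra of a ray consists of the values whose degree
lies on the ray. -/
lemma mem_valueSemigroup_veronese_iff (𝒜 : (Fin m → ℤ) → Submodule K R) [GradedAlgebra 𝒜]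
    (ν : R → (Fin m → ℤ) × (Fin n → ℤ))
    (hmul : ∀ f g : R, f ≠ 0 → g ≠ 0 → ν (f * g) = ν f + ν g)
    (hconst : ∀ c : K, c ≠ 0 → ν (algebraMap K R c) = 0)
    (hhom : ∀ f : R, f ≠ 0 → ∃ u, ((DirectSum.decompose 𝒜 f u : 𝒜 u) : R) ≠ 0 ∧
        ν f = ν ((DirectSum.decompose 𝒜 f u : 𝒜 u) : R))
    (hfullyhom : ∀ (u : Fin m → ℤ) (f : R), f ∈ 𝒜 u → f ≠ 0 → (ν f).1 = u)
    (v : Fin m → ℤ) (s : (Fin m → ℤ) × (Fin n → ℤ)) :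
    s ∈ valueSemigroup ν ((veronese 𝒜 (rayZ v) : Subalgebra K R) : Set R) ↔
      s ∈ valueSemigroup ν (Set.univ : Set R) ∧ s.1 ∈ rayZ v := by
  constructor
  · intro hs
    obtain ⟨f, hf, hf0, rfl⟩ := exists_eq_of_mem_valueSemigroup ν hmul hconst _ hs
    refine ⟨AddSubmonoid.subset_closure ⟨f, ⟨Set.mem_univ f, hf0⟩, rfl⟩, ?_⟩
    obtain ⟨u, hu, hνu⟩ := hhom f hf0
    rw [hνu, hfullyhom u _ (SetLike.coe_mem _) hu]
    exact mem_of_decompose_ne_zero_of_mem_veronese 𝒜 (zero_mem_rayZ v)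
      (fun _ h _ h' => add_mem_rayZ h h') hf u hu
  · rintro ⟨hs, hv⟩
    rw [← Algebra.coe_top (R := K)] at hs
    obtain ⟨f, -, hf0, rfl⟩ := exists_eq_of_mem_valueSemigroup ν hmul hconst _ hs
    obtain ⟨u, hu, hνu⟩ := hhom f hf0
    rw [hνu] at hv ⊢
    rw [hfullyhom u _ (SetLike.coe_mem _) hu] at hv
    refine AddSubmonoid.subset_closure ⟨_, ⟨Algebra.subset_adjoin ?_, hu⟩, rfl⟩
    exact Set.mem_biUnion hv (SetLike.coe_mem _)

/-- If the value semigroup is finitely generated, its generators span the valuation cone. -/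
lemma valuationCone_eq_of_fg {ν : R → (Fin m → ℤ) × (Fin n → ℤ)} {A : Set R}
    {G : Finset ((Fin m → ℤ) × (Fin n → ℤ))}
    (hG : AddSubmonoid.closure (G : Set _) = valueSemigroup ν A) :
    valuationCone ν A =
      {x | ∃ a : G → ℝ, (∀ i, 0 ≤ a i) ∧ ∑ i, a i • embG m n i = x} := by
  have hrange : embG m n '' (G : Set _) = Set.range fun i : G => embG m n i := by
    rw [Set.image_eq_range]
    rfl
  rw [valuationCone, ← hG, span_embG_closure, hrange, (isClosed_span_nnreal_range _).closure_eq]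
  ext x
  exact mem_span_nnreal_range_iff _ x

lemma isClosed_setOf_smul {E : Type*} [NormedAddCommGroup E] [NormedSpace ℝ E] (w : E) :
    IsClosed {y | ∃ c : ℝ, 0 ≤ c ∧ y = c • w} := by
  convert isClosed_span_nnreal_range (fun _ : Unit => w) using 1
  ext y
  rw [SetLike.mem_coe, mem_span_nnreal_range_iff]
  constructor
  · rintro ⟨c, hc, rfl⟩
    exact ⟨fun _ => c, fun _ => hc, by simp⟩
  · rintro ⟨a, ha, rfl⟩
    exact ⟨a (), ha (), by simp⟩

lemma fst_mem_ray_of_mem_span {w : Fin m → ℤ} {s : Set ((Fin m → ℤ) × (Fin n → ℤ))}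
    (hs : ∀ x ∈ s, x.1 ∈ rayZ w) {x : (Fin m → ℝ) × (Fin n → ℝ)}
    (hx : x ∈ Submodule.span ℝ≥0 (embG m n '' s)) : ∃ c : ℝ, 0 ≤ c ∧ x.1 = c • embM m w := by
  induction hx using Submodule.span_induction with
  | mem x hx =>
    obtain ⟨u, hu, rfl⟩ := hx
    obtain ⟨q, hq, h⟩ := hs u hu
    refine ⟨q, by exact_mod_cast hq, funext fun i => ?_⟩
    have := h i
    simp only [embG, embM, Pi.smul_apply, smul_eq_mul]
    exact_mod_cast this
  | zero => exact ⟨0, le_rfl, by simp⟩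
  | add x y _ _ hx hy =>
    obtain ⟨c, hc, hx⟩ := hx
    obtain ⟨d, hd, hy⟩ := hy
    exact ⟨c + d, add_nonneg hc hd, by rw [Prod.fst_add, hx, hy, add_smul]⟩
  | smul a x _ hx =>
    obtain ⟨c, hc, hx⟩ := hx
    exact ⟨a * c, mul_nonneg a.2 hc, by rw [Prod.smul_fst, hx, NNReal.smul_def, smul_smul]⟩

/-- **Theorem 3.3 / Theorem 1.1** (equivalence of (1) and (2)). Let `R` be a finitely
generated `ℤᵐ`-graded domain over an algebraically closed field with `R₀ = K`, and `ν` a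
fully homogeneous valuation whose valuation cone `C(R,ν)` is rational polyhedral. Then the
value semigroup `S(R,ν)` is finitely generated iff for every nonzero `v = (v₁,v₂) ∈ ℤᵐ × ℤⁿ`
whose nonnegative ray lies in `C(R,ν)`, the value semigroup of the Veronese subalgebra
`R(ray(v₁))` is finitely generated and its valuation cone equals `C(R,ν) ∩ π⁻¹(ℝ≥0·v̄₁)`. -/
theorem khovanskii_finite_iff_rays
    (𝒜 : (Fin m → ℤ) → Submodule K R) [GradedAlgebra 𝒜]
    (hfg : Algebra.FiniteType K R)
    (h0 : 𝒜 0 = Submodule.span K {(1 : R)})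
    (le : ((Fin m → ℤ) × (Fin n → ℤ)) → ((Fin m → ℤ) × (Fin n → ℤ)) → Prop)
    (hlin : IsLinearOrder _ le)
    (hinv : ∀ a b c, le a b → le (c + a) (c + b))
    (ν : R → (Fin m → ℤ) × (Fin n → ℤ))
    (hmul : ∀ f g : R, f ≠ 0 → g ≠ 0 → ν (f * g) = ν f + ν g)
    (hadd : ∀ f g : R, f ≠ 0 → g ≠ 0 → f + g ≠ 0 →
      le (ν f) (ν (f + g)) ∨ le (ν g) (ν (f + g)))
    (hconst : ∀ c : K, c ≠ 0 → ν (algebraMap K R c) = 0)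
    (hhom : ∀ f : R, f ≠ 0 →
      (∃ u, ((DirectSum.decompose 𝒜 f u : 𝒜 u) : R) ≠ 0 ∧
        ν f = ν ((DirectSum.decompose 𝒜 f u : 𝒜 u) : R)) ∧
      ∀ u, ((DirectSum.decompose 𝒜 f u : 𝒜 u) : R) ≠ 0 →
        le (ν f) (ν ((DirectSum.decompose 𝒜 f u : 𝒜 u) : R)))
    (hfullyhom : ∀ (u : Fin m → ℤ) (f : R), f ∈ 𝒜 u → f ≠ 0 → (ν f).1 = u)
    (hpoly : ∃ T : Finset ((Fin m → ℤ) × (Fin n → ℤ)),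
      valuationCone ν (Set.univ : Set R) =
        (Submodule.span ℝ≥0 (embG m n '' (T : Set _)) : Submodule ℝ≥0 _)) :
    (valueSemigroup ν (Set.univ : Set R)).FG ↔
      ∀ v : (Fin m → ℤ) × (Fin n → ℤ), v ≠ 0 →
        {x | ∃ c : ℝ, 0 ≤ c ∧ x = c • embG m n v} ⊆ valuationCone ν (Set.univ : Set R) →
        ((valueSemigroup ν ((veronese 𝒜 (rayZ v.1) : Subalgebra K R) : Set R)).FG ∧
          valuationCone ν ((veronese 𝒜 (rayZ v.1) : Subalgebra K R) : Set R) =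
            valuationCone ν (Set.univ : Set R) ∩
              Prod.fst ⁻¹' {y | ∃ c : ℝ, 0 ≤ c ∧ y = c • embM m v.1}) := by
  have hmem := mem_valueSemigroup_veronese_iff 𝒜 ν hmul hconst (fun f hf => (hhom f hf).1) hfullyhom
  constructor
  · intro hFG v _ _
    refine ⟨fg_of_mem_iff_fst_mem_rayZ hFG v.1 (hmem v.1), Set.Subset.antisymm ?_ ?_⟩
    · refine Set.subset_inter (closure_mono (Submodule.span_mono (Set.image_mono
        fun s hs => ((hmem v.1 s).mp hs).1))) ?_
      exact closure_minimal
        (fun x hx => fst_mem_ray_of_mem_span (fun s hs => ((hmem v.1 s).mp hs).2) hx)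
        ((isClosed_setOf_smul _).preimage continuous_fst)
    · rintro x ⟨hx, c, hc, hxc⟩
      obtain ⟨G, hG⟩ := hFG
      rw [valuationCone_eq_of_fg hG] at hx
      obtain ⟨a, ha, rfl⟩ := hx
      refine closure_mono (Submodule.span_mono (Set.image_mono fun s hs => ?_))
        (mem_closure_span_of_fst_mem_ray _ v.1 a ha c hc hxc)
      refine (hmem v.1 s).mpr ⟨?_, hs.2⟩
      rw [← hG]
      simpa using hs.1
  · intro hrays
    obtain ⟨T, hT⟩ := hpoly
    have hmul_mem : ∀ v : T, ∃ k : ℕ, 0 < k ∧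
        k • (v : (Fin m → ℤ) × (Fin n → ℤ)) ∈ valueSemigroup ν (Set.univ : Set R) := by
      rintro ⟨v, hvT⟩
      by_cases hv : v = 0
      · exact ⟨1, one_pos, by simp [hv]⟩
      have hray : {x | ∃ c : ℝ, 0 ≤ c ∧ x = c • embG m n v} ⊆
          valuationCone ν (Set.univ : Set R) := by
        rintro _ ⟨c, hc, rfl⟩
        rw [hT]
        exact Submodule.smul_mem _ (⟨c, hc⟩ : ℝ≥0) (Submodule.subset_span ⟨v, hvT, rfl⟩)
      obtain ⟨⟨G, hG⟩, hcone⟩ := hrays v hv hray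
      have hvcone : embG m n v ∈
          valuationCone ν ((veronese 𝒜 (rayZ v.1) : Subalgebra K R) : Set R) := by
        rw [hcone]
        exact ⟨hray ⟨1, zero_le_one, (one_smul _ _).symm⟩, 1, zero_le_one, (one_smul _ _).symm⟩
      rw [valuationCone_eq_of_fg hG] at hvcone
      obtain ⟨a, ha, hsum⟩ := hvcone
      obtain ⟨k, hk, l, hl⟩ := exists_nsmul_eq_sum_of_cone _ v a ha hsum
      refine ⟨k, hk, ((hmem v.1 _).mp ?_).1⟩
      rw [hl, ← hG]
      exact sum_mem fun i _ => nsmul_mem (AddSubmonoid.subset_closure i.2) _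
    choose k hk hkmem using hmul_mem
    refine fg_of_subset_cone _ (fun v : T => k v • (v : (Fin m → ℤ) × (Fin n → ℤ))) hkmem
      fun s hs => ?_
    have hs' : embG m n s ∈ valuationCone ν (Set.univ : Set R) :=
      subset_closure (Submodule.subset_span ⟨s, hs, rfl⟩)
    rw [hT, Set.image_eq_range, SetLike.mem_coe] at hs'
    obtain ⟨a, ha, hsum⟩ := (mem_span_nnreal_range_iff (fun v : T => embG m n v) _).mp hs'
    refine ⟨fun v => a v / k v, fun v => div_nonneg (ha v) (Nat.cast_nonneg _), ?_⟩
    rw [← hsum]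
    refine Finset.sum_congr rfl fun v _ => ?_
    have hkv : (k v : ℝ) ≠ 0 := by exact_mod_cast (hk v).ne'
    rw [embG_nsmul, smul_smul, div_mul_cancel₀ _ hkv]

end
end

section
/- Let M' be a subgroup of ℤᵐ of finite index. Let x ∈ FractionRing R be homogeneous of degree w for some w ∈ M'. Then x is integral over (the image of) R if and only if x is integral over (the image of) the Veronese subalgebra R(M'). (This is the element-wise form of Lemma 3.6(1) of the paper: the normalization of the Veronese subalgebra R(M') equals the degree-M' part of the normalization of R.) -/
noncomputable section

variable {K R : Type} [Field K] [CommRing R] [IsDomain R] [Algebra K R]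
variable {m : ℕ}

/-- An element of the fraction field is homogeneous of degree `w` if it is a quotient of
homogeneous elements whose degrees differ by `w`. -/
def IsHomogeneousOfDegree (𝒜 : (Fin m → ℤ) → Submodule K R) (x : FractionRing R)
    (w : Fin m → ℤ) : Prop :=
  ∃ (a b : R) (u v : Fin m → ℤ), a ∈ 𝒜 u ∧ b ∈ 𝒜 v ∧ b ≠ 0 ∧ u - v = w ∧
    x = algebraMap R (FractionRing R) a / algebraMap R (FractionRing R) b

/-- `x` satisfies a monic polynomial equation with coefficients in the set `S`,
i.e. `x` is integral over `S`. -/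
def IsIntegralOverSet {F : Type} [CommRing F] (S : Set F) (x : F) : Prop :=
  ∃ n : ℕ, 0 < n ∧ ∃ c : ℕ → F, (∀ i, c i ∈ S) ∧
    x ^ n + ∑ i ∈ Finset.range n, c i * x ^ i = 0

/-- Clearing denominators in a monic polynomial equation satisfied by the fraction `a / b`. -/
theorem div_pow_add_sum_eq_zero_iff (a : R) {b : R} (hb : b ≠ 0) (n : ℕ) (r : ℕ → R) :
    (algebraMap R (FractionRing R) a / algebraMap R (FractionRing R) b) ^ n +
        ∑ i ∈ Finset.range n, algebraMap R (FractionRing R) (r i) *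
          (algebraMap R (FractionRing R) a / algebraMap R (FractionRing R) b) ^ i = 0 ↔
      a ^ n + ∑ i ∈ Finset.range n, r i * (a ^ i * b ^ (n - i)) = 0 := by
  have hb' : algebraMap R (FractionRing R) b ≠ 0 := by
    simpa using hb
  have key : algebraMap R (FractionRing R)
        (a ^ n + ∑ i ∈ Finset.range n, r i * (a ^ i * b ^ (n - i))) =
      ((algebraMap R (FractionRing R) a / algebraMap R (FractionRing R) b) ^ n +
        ∑ i ∈ Finset.range n, algebraMap R (FractionRing R) (r i) *
          (algebraMap R (FractionRing R) a / algebraMap R (FractionRing R) b) ^ i) *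
        algebraMap R (FractionRing R) b ^ n := by
    simp only [map_add, map_sum, map_mul, map_pow, add_mul, Finset.sum_mul]
    congr 1
    · rw [← mul_pow, div_mul_cancel₀ _ hb']
    · refine Finset.sum_congr rfl fun i hi => ?_
      rw [← Nat.add_sub_of_le (Finset.mem_range.mp hi).le, pow_add, Nat.add_sub_cancel_left,
        div_pow]
      field_simp
  rw [← map_eq_zero_iff (algebraMap R (FractionRing R)) (IsFractionRing.injective R _), key,
    mul_eq_zero, or_iff_left (pow_ne_zero n hb')]

/-- An equation of integral dependence between homogeneous elements `a` and `b` persists after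
replacing its coefficients by their components of the expected degrees. -/
theorem pow_add_sum_decompose_eq_zero (𝒜 : (Fin m → ℤ) → Submodule K R) [GradedAlgebra 𝒜]
    {a b : R} {u v : Fin m → ℤ} (ha : a ∈ 𝒜 u) (hb : b ∈ 𝒜 v) (n : ℕ) (r : ℕ → R)
    (h : a ^ n + ∑ i ∈ Finset.range n, r i * (a ^ i * b ^ (n - i)) = 0) :
    a ^ n + ∑ i ∈ Finset.range n,
      (DirectSum.decompose 𝒜 (r i) ((n - i) • (u - v)) : R) * (a ^ i * b ^ (n - i)) = 0 := by
  have h' := congrArg (GradedRing.proj 𝒜 (n • u)) h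
  simp only [map_add, map_sum, map_zero, GradedRing.proj_apply] at h'
  rw [DirectSum.decompose_of_mem_same 𝒜 (SetLike.pow_mem_graded n ha)] at h'
  rw [← h']
  congr 1
  refine Finset.sum_congr rfl fun i hi => ?_
  have hdeg : n • u = (n - i) • (u - v) + (i • u + (n - i) • v) := by
    rw [smul_sub, ← add_assoc, add_right_comm, sub_add_cancel, ← add_smul,
      Nat.sub_add_cancel (Finset.mem_range.mp hi).le]
  rw [hdeg, DirectSum.coe_decompose_mul_add_of_right_mem 𝒜
    (SetLike.mul_mem_graded (SetLike.pow_mem_graded i ha) (SetLike.pow_mem_graded (n - i) hb))]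

/-- **Lemma 3.6(1), element-wise form.** Let `M'` be a finite index subgroup of `ℤᵐ` and let
`x` in the fraction field of the `ℤᵐ`-graded domain `R` be homogeneous of degree `w ∈ M'`.
Then `x` is integral over (the image of) `R` iff `x` is integral over (the image of) the
Veronese subalgebra `R(M')`. -/
theorem integral_iff_integral_veronese_finiteIndex
    (𝒜 : (Fin m → ℤ) → Submodule K R) [GradedAlgebra 𝒜]
    (M' : AddSubgroup (Fin m → ℤ)) (hM' : M'.FiniteIndex)
    (w : Fin m → ℤ) (hw : w ∈ M')
    (x : FractionRing R) (hx : IsHomogeneousOfDegree 𝒜 x w) :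
    IsIntegralOverSet (Set.range (algebraMap R (FractionRing R))) x ↔
      IsIntegralOverSet
        (algebraMap R (FractionRing R) ''
          ((veronese 𝒜 (M' : Set (Fin m → ℤ)) : Subalgebra K R) : Set R)) x := by
  constructor
  · obtain ⟨a, b, u, v, ha, hb, hb0, rfl, rfl⟩ := hx
    rintro ⟨n, hn, c, hc, h⟩
    choose r hr using hc
    simp only [← hr] at h
    refine ⟨n, hn, fun i => algebraMap R (FractionRing R)
      (DirectSum.decompose 𝒜 (r i) ((n - i) • (u - v))), fun i => ?_, ?_⟩
    · exact Set.mem_image_of_mem _ (Algebra.subset_adjoin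
        (Set.mem_biUnion (M'.nsmul_mem hw (n - i)) (SetLike.coe_mem _)))
    · exact (div_pow_add_sum_eq_zero_iff a hb0 n _).mpr
        (pow_add_sum_decompose_eq_zero 𝒜 ha hb n r
          ((div_pow_add_sum_eq_zero_iff a hb0 n r).mp h))
  · rintro ⟨n, hn, c, hc, h⟩
    exact ⟨n, hn, c, fun i => Set.image_subset_range _ _ (hc i), h⟩

end
end

section
/- Assume R and its normalization R̄ are both generated in degree one. Suppose p and q are polynomials with rational coefficients such that for all sufficiently large k ∈ ℕ, finrank_K(𝒜 k) = p(k) and finrank_K(R̄_k) = q(k). Then p and q have the same degree and the same leading coefficient. (Lemma 3.7 of the paper: the projective varieties Proj R and Proj R̄ have the same degree.) -/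
open Filter

noncomputable section

variable {K R : Type} [Field K] [IsAlgClosed K] [CommRing R] [IsDomain R] [Algebra K R]

/-- The set of elements of the fraction field which are zero or homogeneous of degree `k`,
for an `ℕ`-graded domain `R`. -/
def homogeneousDegreeSet (𝒜 : ℕ → Submodule K R) (k : ℕ) : Set (FractionRing R) :=
  {x | x = 0 ∨ ∃ (j : ℕ) (a b : R), a ∈ 𝒜 (j + k) ∧ b ∈ 𝒜 j ∧ b ≠ 0 ∧
    x = algebraMap R (FractionRing R) a / algebraMap R (FractionRing R) b}

section Polynomials

open Polynomial

/-- A rational polynomial with eventually nonnegative values on `ℕ` has nonnegative leading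
coefficient. -/
theorem Polynomial.leadingCoeff_nonneg_of_eventually_eval_natCast_nonneg {f : ℚ[X]}
    (h : ∀ᶠ k : ℕ in atTop, 0 ≤ f.eval (k : ℚ)) : 0 ≤ f.leadingCoeff := by
  by_contra! hlc
  rcases lt_or_ge 0 f.degree with hd | hd
  · have ht := (f.tendsto_atBot_of_leadingCoeff_nonpos hd hlc.le).comp
      (tendsto_natCast_atTop_atTop (R := ℚ))
    obtain ⟨k, hk, hk'⟩ := (h.and (ht.eventually_lt_atBot 0)).exists
    exact absurd hk (not_le.mpr hk')
  · obtain ⟨k, hk⟩ := h.exists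
    rw [eq_C_of_degree_le_zero hd] at hk hlc
    simp only [eval_C, leadingCoeff_C] at hk hlc
    exact absurd hk (not_le.mpr hlc)

/-- Domination of values on large naturals bounds the degree. -/
theorem Polynomial.degree_le_of_eventually_eval_natCast_le {f g : ℚ[X]}
    (hf : ∀ᶠ k : ℕ in atTop, 0 ≤ f.eval (k : ℚ))
    (hfg : ∀ᶠ k : ℕ in atTop, f.eval (k : ℚ) ≤ g.eval (k : ℚ)) : f.degree ≤ g.degree := by
  by_contra! hlt
  have hsub : 0 ≤ (g - f).leadingCoeff :=
    leadingCoeff_nonneg_of_eventually_eval_natCast_nonneg (by simpa using hfg)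
  rw [leadingCoeff_sub_of_degree_lt' hlt] at hsub
  have hf0 := leadingCoeff_nonneg_of_eventually_eval_natCast_nonneg hf
  have : f = 0 := leadingCoeff_eq_zero.mp (by linarith)
  simp [this] at hlt

/-- Among polynomials of equal degree, domination of values on large naturals bounds the leading
coefficient. -/
theorem Polynomial.leadingCoeff_le_of_eventually_eval_natCast_le {f g : ℚ[X]}
    (hd : f.degree = g.degree)
    (hfg : ∀ᶠ k : ℕ in atTop, f.eval (k : ℚ) ≤ g.eval (k : ℚ)) :
    f.leadingCoeff ≤ g.leadingCoeff := by
  by_contra! hlt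
  have hsub : 0 ≤ (g - f).leadingCoeff :=
    leadingCoeff_nonneg_of_eventually_eval_natCast_nonneg (by simpa using hfg)
  rw [leadingCoeff_sub_of_degree_eq hd.symm hlt.ne] at hsub
  linarith

/-- A polynomial squeezed between `p k` and `p (k + d)` has the degree and leading coefficient
of `p`. -/
theorem Polynomial.degree_leadingCoeff_eq_of_eventually_le_shift {p q : ℚ[X]} (d : ℕ)
    (hp : ∀ᶠ k : ℕ in atTop, 0 ≤ p.eval (k : ℚ))
    (hpq : ∀ᶠ k : ℕ in atTop, p.eval (k : ℚ) ≤ q.eval (k : ℚ))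
    (hqp : ∀ᶠ k : ℕ in atTop, q.eval (k : ℚ) ≤ p.eval ((k + d : ℕ) : ℚ)) :
    p.degree = q.degree ∧ p.leadingCoeff = q.leadingCoeff := by
  have hdeg : (taylor (d : ℚ) p).degree = p.degree := degree_taylor p _
  have hlc : (taylor (d : ℚ) p).leadingCoeff = p.leadingCoeff := leadingCoeff_taylor _ _
  have hqp' : ∀ᶠ k : ℕ in atTop, q.eval (k : ℚ) ≤ (taylor (d : ℚ) p).eval (k : ℚ) := by
    simpa [taylor_eval, add_comm] using hqp
  have hq : ∀ᶠ k : ℕ in atTop, 0 ≤ q.eval (k : ℚ) := by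
    filter_upwards [hp, hpq] with k h₁ h₂ using h₁.trans h₂
  have h : p.degree = q.degree :=
    (degree_le_of_eventually_eval_natCast_le hp hpq).antisymm
      (hdeg ▸ degree_le_of_eventually_eval_natCast_le hq hqp')
  exact ⟨h, (leadingCoeff_le_of_eventually_eval_natCast_le h hpq).antisymm
    (hlc ▸ leadingCoeff_le_of_eventually_eval_natCast_le (h.symm.trans hdeg.symm) hqp')⟩

end Polynomials
section Finiteness

/-- If a ring homomorphism out of an algebra `B` over a Noetherian ring `A` is injective and makes
its target finite over `A`, then `B` is finite over `A`. -/
theorem Module.Finite.of_injective_ringHom_comp_finite {A B C : Type*} [CommRing A]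
    [IsNoetherianRing A] [CommRing B] [Algebra A B] [CommRing C] (g : B →+* C)
    (hg : Function.Injective g) (hfin : (g.comp (algebraMap A B)).Finite) :
    Module.Finite A B := by
  algebraize [g.comp (algebraMap A B)]
  let l : B →ₗ[A] C :=
    { toFun := g
      map_add' := map_add g
      map_smul' := fun a b => by
        rw [Algebra.smul_def, Algebra.smul_def, map_mul]; rfl }
  exact Module.Finite.of_injective l hg

/-- The Frobenius of a finite type algebra over a perfect field is finite. -/
theorem iterateFrobenius_finite_of_finiteType (k A : Type*) [Field k] [CommRing A] [Algebra k A]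
    [Algebra.FiniteType k A] (p n : ℕ) [ExpChar k p] [ExpChar A p] [PerfectRing k p] :
    (iterateFrobenius A p n).Finite := by
  refine RingHom.IsIntegral.to_finite (fun x => ?_) ?_
  · refine ⟨Polynomial.X ^ p ^ n - Polynomial.C x,
      Polynomial.monic_X_pow_sub_C x (expChar_pow_pos k p n).ne', ?_⟩
    simp [iterateFrobenius_def]
  · have hcomp : (iterateFrobenius A p n).comp (algebraMap k A) =
        (algebraMap k A).comp (iterateFrobenius k p n) :=
      RingHom.ext fun x => by simp [iterateFrobenius_def]
    refine RingHom.FiniteType.of_comp_finiteType (f := algebraMap k A) ?_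
    rw [hcomp]
    exact (RingHom.finiteType_algebraMap.mpr inferInstance).comp
      (RingHom.FiniteType.of_surjective _ (bijective_iterateFrobenius k p n).surjective)

/-- The integral closure of a normal finite type domain over a perfect field in a finite extension
of its fraction field is finite. -/
theorem finite_integralClosure_of_isIntegrallyClosed (k A E L : Type*) [Field k] [PerfectField k]
    [CommRing A] [IsDomain A] [IsIntegrallyClosed A] [Algebra k A] [Algebra.FiniteType k A]
    [Field E] [Algebra A E] [IsFractionRing A E] [Field L] [Algebra E L] [Algebra A L]
    [IsScalarTower A E L] [FiniteDimensional E L] :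
    Module.Finite A (integralClosure A L) := by
  have : IsNoetherianRing A := Algebra.FiniteType.isNoetherianRing k A
  obtain ⟨p, _⟩ := ExpChar.exists k
  have : ExpChar A p := expChar_of_injective_algebraMap (algebraMap k A).injective p
  have : ExpChar E p := expChar_of_injective_algebraMap (IsFractionRing.injective A E) p
  let S := separableClosure E L
  have : ExpChar S p := expChar_of_injective_algebraMap (algebraMap E S).injective p
  let φ : L →+* S := IsPurelyInseparable.iterateFrobenius S L p le_rfl
  set n := IsPurelyInseparable.exponent S L
  have hφ (x : L) : algebraMap S L (φ x) = x ^ p ^ n :=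
    IsPurelyInseparable.algebraMap_iterateFrobenius S p le_rfl x
  have : IsScalarTower A S L := ⟨fun a x y => smul_mul_assoc a (x : L) y⟩
  have hint (x : integralClosure A L) : φ x ∈ integralClosure A S := by
    refine (isIntegral_algebraMap_iff (algebraMap S L).injective).mp ?_
    rw [hφ]
    exact x.2.pow _
  let g : integralClosure A L →+* integralClosure A S :=
    (φ.comp (integralClosure A L).val.toRingHom).codRestrict (integralClosure A S) hint
  have hg : Function.Injective g := fun x y h =>
    Subtype.ext (φ.injective (congrArg Subtype.val h))
  have hcomp : g.comp (algebraMap A (integralClosure A L)) =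
      (algebraMap A (integralClosure A S)).comp (iterateFrobenius A p n) := by
    refine RingHom.ext fun a => Subtype.ext ((algebraMap S L).injective ?_)
    change algebraMap S L (φ (algebraMap A L a)) = algebraMap S L (algebraMap A S (a ^ p ^ n))
    rw [hφ, ← IsScalarTower.algebraMap_apply, map_pow]
  have : Module.Finite A (integralClosure A S) :=
    IsIntegralClosure.finite A E S (integralClosure A S)
  refine Module.Finite.of_injective_ringHom_comp_finite g hg ?_
  rw [hcomp]
  exact (RingHom.finite_algebraMap.mpr inferInstance).comp
    (iterateFrobenius_finite_of_finiteType k A p n)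

/-- **Finiteness of normalization** for finite type domains over a perfect field. -/
theorem fg_integralClosure_fractionRing (k A : Type*) [Field k] [PerfectField k]
    [CommRing A] [IsDomain A] [Algebra k A] [Algebra.FiniteType k A] :
    (Subalgebra.toSubmodule (integralClosure A (FractionRing A))).FG := by
  obtain ⟨s, g, hg, hgf⟩ := exists_finite_inj_algHom_of_fg k A
  let P := MvPolynomial (Fin s) k
  let L := FractionRing A
  let : Algebra P A := g.toRingHom.toAlgebra
  have : Module.Finite P A := hgf
  have : FaithfulSMul P A := (faithfulSMul_iff_algebraMap_injective P A).mpr hg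
  have : FaithfulSMul P L := (faithfulSMul_iff_algebraMap_injective P L).mpr <| by
    rw [IsScalarTower.algebraMap_eq P A L]
    exact (IsFractionRing.injective A L).comp hg
  let : Algebra (FractionRing P) L := FractionRing.liftAlgebra P L
  have : FiniteDimensional (FractionRing P) L := inferInstance
  have hfin := finite_integralClosure_of_isIntegrallyClosed k P (FractionRing P) L
  have hPA : (Subalgebra.toSubmodule (integralClosure A L)).restrictScalars P =
      Subalgebra.toSubmodule (integralClosure P L) := by
    ext x
    exact ⟨fun h => isIntegral_trans (R := P) x h, fun h => IsIntegral.tower_top h⟩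
  refine Submodule.FG.of_restrictScalars P ?_
  rw [hPA]
  exact Module.Finite.iff_fg.mp hfin

/-- A common denominator for the normalization of a finite type domain over a perfect field. -/
theorem exists_ne_zero_mul_integralClosure_mem_range (k A : Type*) [Field k] [PerfectField k]
    [CommRing A] [IsDomain A] [Algebra k A] [Algebra.FiniteType k A] :
    ∃ b : A, b ≠ 0 ∧ ∀ x ∈ integralClosure A (FractionRing A), ∃ r : A,
      algebraMap A (FractionRing A) b * x = algebraMap A (FractionRing A) r := by
  obtain ⟨b, hb, h⟩ := FractionalIdeal.isFractional_of_fg (S := nonZeroDivisors A)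
    (fg_integralClosure_fractionRing k A)
  refine ⟨b, nonZeroDivisors.ne_zero hb, fun x hx => ?_⟩
  obtain ⟨r, hr⟩ := h x hx
  exact ⟨r, by rw [hr, Algebra.smul_def]⟩

end Finiteness

section Graded

open DirectSum

theorem DirectSum.coe_decompose_mul_eq_sum_antidiagonal {k A : Type*} [CommRing k] [CommRing A]
    [Algebra k A] (𝒜 : ℕ → Submodule k A) [GradedAlgebra 𝒜] (x y : A) (n : ℕ) :
    (decompose 𝒜 (x * y) n : A) =
      ∑ ij ∈ Finset.HasAntidiagonal.antidiagonal n, (decompose 𝒜 x ij.1 : A) * decompose 𝒜 y ij.2 := by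
  rw [decompose_mul, coe_mul_apply_eq_sum_antidiagonal]

/-- The degree one part of a finite type graded algebra with scalars in degree zero is finitely
generated. -/
theorem fg_gradedPiece_one {k A : Type*} [CommRing k] [CommRing A] [Algebra k A]
    [hft : Algebra.FiniteType k A] (𝒜 : ℕ → Submodule k A) [GradedAlgebra 𝒜]
    (h0 : 𝒜 0 = Submodule.span k {(1 : A)}) : (𝒜 1).FG := by
  classical
  obtain ⟨s, hs⟩ := hft.out
  let c : A → A := fun x => decompose 𝒜 x 1
  have key (x : A) : c x ∈ Submodule.span k (c '' (s : Set A)) := by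
    have hx : x ∈ Algebra.adjoin k (s : Set A) := hs ▸ Algebra.mem_top
    induction hx using Algebra.adjoin_induction with
    | mem x hx => exact Submodule.subset_span ⟨x, hx, rfl⟩
    | algebraMap r =>
      have : algebraMap k A r ∈ 𝒜 0 := by
        rw [h0]; exact Submodule.mem_span_singleton.mpr ⟨r, (Algebra.algebraMap_eq_smul_one r).symm⟩
      have hz : c (algebraMap k A r) = 0 := decompose_of_mem_ne 𝒜 this zero_ne_one
      rw [hz]
      exact zero_mem _
    | add x y _ _ hx hy =>
      have : c (x + y) = c x + c y := by simp [c]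
      rw [this]
      exact add_mem hx hy
    | mul x y _ _ hx hy =>
      have hscalar (z : A) : ∃ r : k, r • (1 : A) = decompose 𝒜 z 0 :=
        Submodule.mem_span_singleton.mp (h0 ▸ (decompose 𝒜 z 0).2)
      obtain ⟨r, hr⟩ := hscalar x
      obtain ⟨t, ht⟩ := hscalar y
      have : c (x * y) = r • c y + t • c x := by
        simp only [c]
        rw [coe_decompose_mul_eq_sum_antidiagonal, Finset.Nat.sum_antidiagonal_eq_sum_range_succ_mk,
          Finset.sum_range_succ, Finset.sum_range_one, ← hr, ← ht]
        simp
      rw [this]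
      exact add_mem (Submodule.smul_mem _ _ hy) (Submodule.smul_mem _ _ hx)
  have hW : 𝒜 1 = Submodule.span k (c '' (s : Set A)) := by
    refine le_antisymm (fun x hx => ?_) (Submodule.span_le.mpr ?_)
    · have : c x = x := decompose_of_mem_same 𝒜 hx
      exact this ▸ key x
    · rintro _ ⟨x, -, rfl⟩
      exact (decompose 𝒜 x 1).2
  rw [hW]
  exact Submodule.fg_span (s.finite_toSet.image c)

/-- In a graded algebra generated in degree one, the degree `n` part lies in the `n`-th power of
the degree one part. -/
theorem gradedPiece_le_pow {k A : Type*} [CommRing k] [CommRing A] [Algebra k A]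
    (𝒜 : ℕ → Submodule k A) [GradedAlgebra 𝒜]
    (h1 : Algebra.adjoin k (𝒜 1 : Set A) = ⊤) (n : ℕ) : 𝒜 n ≤ 𝒜 1 ^ n := by
  have key (x : A) : ∀ n, (decompose 𝒜 x n : A) ∈ 𝒜 1 ^ n := by
    have hx : x ∈ Algebra.adjoin k (𝒜 1 : Set A) := h1 ▸ Algebra.mem_top
    induction hx using Algebra.adjoin_induction with
    | mem x hx =>
      intro n
      rcases eq_or_ne 1 n with rfl | hn
      · simp
      · rw [decompose_of_mem_ne 𝒜 hx hn]
        exact zero_mem _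
    | algebraMap r =>
      intro n
      rcases eq_or_ne 0 n with rfl | hn
      · rw [decompose_of_mem_same 𝒜 (SetLike.algebraMap_mem_graded 𝒜 r), pow_zero]
        exact Submodule.algebraMap_mem r
      · rw [decompose_of_mem_ne 𝒜 (SetLike.algebraMap_mem_graded 𝒜 r) hn]
        exact zero_mem _
    | add x y _ _ hx hy =>
      intro n
      simpa using add_mem (hx n) (hy n)
    | mul x y _ _ hx hy =>
      intro n
      rw [coe_decompose_mul_eq_sum_antidiagonal]
      refine sum_mem fun ij hij => ?_
      rw [← Finset.HasAntidiagonal.mem_antidiagonal.mp hij, pow_add]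
      exact Submodule.mul_mem_mul (hx _) (hy _)
  intro x hx
  exact decompose_of_mem_same 𝒜 hx ▸ key x n

/-- The graded pieces of a finite type graded algebra over a field which is generated in degree one
are finite dimensional. -/
theorem finite_gradedPiece {k A : Type*} [Field k] [CommRing A] [Algebra k A]
    [Algebra.FiniteType k A] (𝒜 : ℕ → Submodule k A) [GradedAlgebra 𝒜]
    (h0 : 𝒜 0 = Submodule.span k {(1 : A)})
    (h1 : Algebra.adjoin k (𝒜 1 : Set A) = ⊤) (n : ℕ) : Module.Finite k (𝒜 n) := by
  have : Module.Finite k ↥(𝒜 1 ^ n) := Module.Finite.iff_fg.mpr ((fg_gradedPiece_one 𝒜 h0).pow n)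
  exact Submodule.finiteDimensional_of_le (gradedPiece_le_pow 𝒜 h1 n)

/-- If `b * x` lies in `A` for a homogeneous fraction `x`, then multiplying `x` by a homogeneous
component of `b` gives a homogeneous element of `A`. -/
theorem decompose_mul_mem_map_of_mem_homogeneousDegreeSet {k A : Type} [Field k] [CommRing A]
    [IsDomain A] [Algebra k A] (𝒜 : ℕ → Submodule k A) [GradedAlgebra 𝒜] {n : ℕ}
    {x : FractionRing A} (hx : x ∈ homogeneousDegreeSet 𝒜 n) {b r : A}
    (hr : algebraMap A (FractionRing A) b * x = algebraMap A (FractionRing A) r) (d : ℕ) :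
    algebraMap A (FractionRing A) (decompose 𝒜 b d) * x ∈
      (𝒜 (n + d)).map (Algebra.linearMap A (FractionRing A) |>.restrictScalars k) := by
  obtain rfl | ⟨j, a, c, ha, hc, hc0, rfl⟩ := hx
  · simp
  have hinj := IsFractionRing.injective A (FractionRing A)
  have hc0' : algebraMap A (FractionRing A) c ≠ 0 := by
    rwa [Ne, map_eq_zero_iff _ hinj]
  have hrc : b * a = r * c := by
    apply hinj
    rw [map_mul, map_mul, ← hr]
    field_simp
  have hcomp : (decompose 𝒜 b d : A) * a = decompose 𝒜 r (n + d) * c := by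
    rw [← coe_decompose_mul_add_of_right_mem 𝒜 ha, ← coe_decompose_mul_add_of_right_mem 𝒜 hc, hrc,
      show d + (j + n) = n + d + j by ring]
  refine ⟨decompose 𝒜 r (n + d), (decompose 𝒜 r (n + d)).2, ?_⟩
  change algebraMap A (FractionRing A) (decompose 𝒜 r (n + d)) = _
  rw [← mul_div_assoc, eq_div_iff hc0', ← map_mul, ← map_mul, hcomp]

end Graded

/-- **Lemma 3.7.** Let `R` be a finitely generated `ℕ`-graded domain over an algebraically
closed field with `R₀ = K`, whose normalization `R̄` (inside the fraction field) is also
generated in degree one.  If `p` and `q` are rational polynomials which eventually give the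
dimensions of the graded pieces of `R` resp. `R̄` (the Hilbert polynomials), then `p` and `q`
have the same degree and the same leading coefficient, i.e. `Proj R` and `Proj R̄` have the
same dimension and degree. -/
theorem hilbertPolynomial_degree_leadingCoeff_eq_of_normalization
    (𝒜 : ℕ → Submodule K R) [GradedAlgebra 𝒜]
    (hfg : Algebra.FiniteType K R)
    (h0 : 𝒜 0 = Submodule.span K {(1 : R)})
    -- `N k` is the degree-`k` part `R̄ ∩ H_k` of the normalization, as a `K`-submodule
    (N : ℕ → Submodule K (FractionRing R))
    (hN : ∀ k, (N k : Set (FractionRing R)) =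
      {x | x ∈ integralClosure R (FractionRing R) ∧ x ∈ homogeneousDegreeSet 𝒜 k})
    -- `R` is generated in degree one
    (hR1 : Algebra.adjoin K ((𝒜 1 : Set R)) = (⊤ : Subalgebra K R))
    -- `R̄` is generated in degree one
    (hRbar1 : ((Algebra.adjoin K ((N 1 : Set (FractionRing R)))) : Set (FractionRing R)) =
      (integralClosure R (FractionRing R) : Set (FractionRing R)))
    (p q : Polynomial ℚ)
    (hp : ∀ᶠ k : ℕ in atTop, (Module.finrank K ↥(𝒜 k) : ℚ) = p.eval (k : ℚ))
    (hq : ∀ᶠ k : ℕ in atTop, (Module.finrank K ↥(N k) : ℚ) = q.eval (k : ℚ)) :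
    p.degree = q.degree ∧ p.leadingCoeff = q.leadingCoeff := by
  have : Algebra.FiniteType K R := hfg
  have hfin := finite_gradedPiece 𝒜 h0 hR1
  have hinj := IsFractionRing.injective R (FractionRing R)
  let ι : R →ₗ[K] FractionRing R := (Algebra.linearMap R (FractionRing R)).restrictScalars K
  have hfinrank (k : ℕ) : Module.finrank K ((𝒜 k).map ι) = Module.finrank K (𝒜 k) :=
    (Submodule.equivMapOfInjective ι hinj (𝒜 k)).symm.finrank_eq
  have hmem (k : ℕ) (x : FractionRing R) : x ∈ N k ↔
      x ∈ integralClosure R (FractionRing R) ∧ x ∈ homogeneousDegreeSet 𝒜 k :=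
    Set.ext_iff.mp (hN k) x
  obtain ⟨b, hb0, hb⟩ := exists_ne_zero_mul_integralClosure_mem_range K R
  obtain ⟨d, hd⟩ : ∃ d, (DirectSum.decompose 𝒜 b d : R) ≠ 0 := by
    by_contra! h
    refine hb0 ((DirectSum.decompose 𝒜).injective (DFinsupp.ext fun i => Subtype.ext ?_))
    simpa using h i
  let μ : FractionRing R →ₗ[K] FractionRing R :=
    LinearMap.mulLeft K (algebraMap R (FractionRing R) (DirectSum.decompose 𝒜 b d))
  have hμ : Function.Injective μ :=
    mul_right_injective₀ ((map_ne_zero_iff _ hinj).mpr hd)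
  have hNle (k : ℕ) : (N k).map μ ≤ (𝒜 (k + d)).map ι := by
    rintro _ ⟨x, hx, rfl⟩
    obtain ⟨hxint, hxhom⟩ := (hmem k x).mp hx
    obtain ⟨r, hr⟩ := hb x hxint
    exact decompose_mul_mem_map_of_mem_homogeneousDegreeSet 𝒜 hxhom hr d
  have hleN (k : ℕ) : (𝒜 k).map ι ≤ N k := by
    rintro _ ⟨a, ha, rfl⟩
    refine (hmem k _).mpr ⟨isIntegral_algebraMap, Or.inr ⟨0, a, 1, ?_, ?_, one_ne_zero, ?_⟩⟩
    · rwa [zero_add]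
    · exact SetLike.GradedOne.one_mem
    · simp [ι]
  have hfinN (k : ℕ) : Module.Finite K (N k) :=
    have : Module.Finite K ((N k).map μ) := Submodule.finiteDimensional_of_le (hNle k)
    Module.Finite.equiv (Submodule.equivMapOfInjective μ hμ (N k)).symm
  have hlower (k : ℕ) : Module.finrank K (𝒜 k) ≤ Module.finrank K (N k) :=
    hfinrank k ▸ Submodule.finrank_mono (hleN k)
  have hupper (k : ℕ) : Module.finrank K (N k) ≤ Module.finrank K (𝒜 (k + d)) := by
    rw [← hfinrank, (Submodule.equivMapOfInjective μ hμ (N k)).finrank_eq]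
    exact Submodule.finrank_mono (hNle k)
  refine Polynomial.degree_leadingCoeff_eq_of_eventually_le_shift d ?_ ?_ ?_
  · filter_upwards [hp] with k hk
    exact hk ▸ Nat.cast_nonneg _
  · filter_upwards [hp, hq] with k hk hk'
    rw [← hk, ← hk']
    exact_mod_cast hlower k
  · filter_upwards [(tendsto_add_atTop_nat d).eventually hp, hq] with k hk hk'
    rw [← hk, ← hk']
    exact_mod_cast hupper k

end
end

section
/- Let K be an algebraically closed field, let d ≥ 1, and let L ⊆ Sym^d be a K-subspace with 3 ≤ finrank_K L which has degree d (i.e. there is c ∈ ℤ with finrank_K(L^k) = d·k + c for all sufficiently large k). Then for every Q = (α, β) ∈ K × K with (α, β) ≠ (0, 0): the value semigroup S(L, Q) is finitely generated if and only if there exists k > 0 such that (β·s − α·t)^{d·k} ∈ L^k. (Theorem 4.7 of the paper.) -/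
open MvPolynomial Filter

noncomputable section

variable {K : Type} [Field K]

/-- The linear form `β·s − α·t` in `K[s,t]`, cutting out the point `Q = (α : β)` of `ℙ¹`. -/
def lform (α β : K) : MvPolynomial (Fin 2) K := C β * X 0 - C α * X 1

/-- The value semigroup `S(L, Q) = {(k, ord_Q f) : f ∈ L^k, f ≠ 0}` of the homogeneous
valuation `ν_Q` on `R(L) = ⨁ₖ L^k`, where `ord_Q f` is the largest `e` such that
`(β·s − α·t)^e` divides `f`. -/
def curveValueSemigroup (L : Submodule K (MvPolynomial (Fin 2) K)) (α β : K) :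
    AddSubmonoid (ℤ × ℤ) :=
  AddSubmonoid.closure
    {p | ∃ (k e : ℕ) (f : MvPolynomial (Fin 2) K), f ∈ L ^ k ∧ f ≠ 0 ∧
      (lform α β) ^ e ∣ f ∧ ¬ (lform α β) ^ (e + 1) ∣ f ∧ p = ((k : ℤ), (e : ℤ))}

theorem exists_minimal_le_and_finite_setOf_minimal (A : Set (ℕ × ℕ)) :
    {x | Minimal (· ∈ A) x}.Finite ∧ ∀ x ∈ A, ∃ y ≤ x, Minimal (· ∈ A) y :=
  ⟨WellQuasiOrderedLE.finite_of_isAntichain (setOfPred_minimal_antichain _),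
    fun x hx => exists_minimal_le_of_wellFoundedLT _ x hx⟩

/-- A submonoid of the lattice points of a cone `0 ≤ e ≤ d * k` which meets both boundary rays
is finitely generated. -/
theorem AddSubmonoid.fg_of_mem_boundary_rays {S : AddSubmonoid (ℤ × ℤ)} {d m : ℕ}
    (hd : 0 < d) (hm : 0 < m) (h₀ : ((1 : ℤ), (0 : ℤ)) ∈ S)
    (h₁ : ((m : ℤ), (d * m : ℤ)) ∈ S) (hS : ∀ p ∈ S, 0 ≤ p.2 ∧ p.2 ≤ d * p.1) : S.FG := by
  let point (r : ℕ) (x : ℕ × ℕ) : ℤ × ℤ := (x.1 + m * x.2, r + d * m * x.2)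
  let A (r : ℕ) : Set (ℕ × ℕ) := {x | point r x ∈ S}
  let G : Set (ℤ × ℤ) := {((1 : ℤ), (0 : ℤ)), ((m : ℤ), (d * m : ℤ))} ∪
    ⋃ r ∈ Set.Iio (d * m), point r '' {x | Minimal (· ∈ A r) x}
  refine AddSubmonoid.fg_iff _ |>.mpr ⟨G, le_antisymm ?_ ?_, ?_⟩
  · refine AddSubmonoid.closure_le.mpr (Set.union_subset ?_ ?_)
    · rintro p (rfl | rfl)
      exacts [h₀, h₁]
    · refine Set.iUnion₂_subset fun r _ => ?_
      rintro _ ⟨x, hx, rfl⟩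
      exact hx.prop
  · rintro ⟨k, e⟩ hp
    obtain ⟨he, hek⟩ := hS _ hp
    dsimp only at he hek
    lift e to ℕ using he
    have hn : 0 < d * m := Nat.mul_pos hd hm
    have hdiv := Nat.mod_add_div e (d * m)
    have hlt := Nat.mod_lt e hn
    generalize e % (d * m) = r at hdiv hlt
    generalize e / (d * m) = b at hdiv
    have ha : (0 : ℤ) ≤ k - m * b := by
      have h : (d : ℤ) * (m * b) ≤ d * k := by
        have : (r : ℤ) + d * m * b = e := by exact_mod_cast hdiv
        nlinarith [Int.natCast_nonneg r]
      exact sub_nonneg.mpr (le_of_mul_le_mul_left h (by exact_mod_cast hd))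
    obtain ⟨a, ha⟩ := Int.eq_ofNat_of_zero_le ha
    have hpoint : ((k, (e : ℤ)) : ℤ × ℤ) = point r (a, b) := by
      ext
      · simp only [point]; linarith
      · simp only [point]; exact_mod_cast hdiv.symm
    rw [hpoint] at hp ⊢
    obtain ⟨⟨a', b'⟩, ⟨haa, hbb⟩, hmin⟩ :=
      (exists_minimal_le_and_finite_setOf_minimal (A r)).2 (a, b) hp
    obtain ⟨u, rfl⟩ := Nat.exists_eq_add_of_le haa
    obtain ⟨v, rfl⟩ := Nat.exists_eq_add_of_le hbb
    have hsplit : point r (a' + u, b' + v) =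
        point r (a', b') + u • ((1 : ℤ), (0 : ℤ)) + v • ((m : ℤ), (d * m : ℤ)) := by
      ext <;> simp [point] <;> ring
    dsimp only
    rw [hsplit]
    have hmem {p : ℤ × ℤ} (hp : p ∈ G) : p ∈ AddSubmonoid.closure G :=
      AddSubmonoid.subset_closure hp
    exact add_mem (add_mem (hmem (Or.inr (Set.mem_iUnion₂.mpr ⟨r, hlt, _, hmin, rfl⟩)))
      (nsmul_mem (hmem (Or.inl (Or.inl rfl))) _)) (nsmul_mem (hmem (Or.inl (Or.inr rfl))) _)
  · exact (Set.toFinite _).union ((Set.finite_Iio _).biUnion fun r _ =>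
      (exists_minimal_le_and_finite_setOf_minimal (A r)).1.image _)

theorem finrank_homogeneousSubmodule_fin_two (n : ℕ) :
    Module.finrank K (homogeneousSubmodule (Fin 2) K n) = n + 1 := by
  let e : {x : Fin 2 →₀ ℕ | x.degree = n} ≃ Finset.HasAntidiagonal.antidiagonal n :=
    { toFun := fun x => ⟨(x.1 0, x.1 1), by
        have := x.2
        simpa [Finsupp.degree_eq_sum, Fin.sum_univ_two] using this⟩
      invFun := fun y => ⟨Finsupp.equivFunOnFinite.symm ![y.1.1, y.1.2], by
        have := Finset.HasAntidiagonal.mem_antidiagonal.mp y.2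
        simpa [Finsupp.degree_eq_sum, Fin.sum_univ_two] using this⟩
      left_inv := fun x => by
        ext i
        fin_cases i <;> rfl
      right_inv := fun y => rfl }
  have : Fintype {x : Fin 2 →₀ ℕ | x.degree = n} := Fintype.ofEquiv _ e.symm
  rw [homogeneousSubmodule_eq_finsupp_supported,
    (AddMonoidAlgebra.supportedEquivFinsupp _).finrank_eq, Module.finrank_finsupp_self,
    Fintype.card_congr e]
  simp

instance (n : ℕ) : FiniteDimensional K (homogeneousSubmodule (Fin 2) K n) :=
  Module.Finite.iff_fg.mpr (homogeneousSubmodule_fg (Fin 2) K n)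

theorem homogeneousSubmodule_pow_le (σ R : Type*) [CommSemiring R] (n k : ℕ) :
    homogeneousSubmodule σ R n ^ k ≤ homogeneousSubmodule σ R (n * k) := by
  induction k with
  | zero => simp
  | succ k ih =>
    rw [pow_succ]
    exact (mul_le_mul_left ih _).trans (homogeneousSubmodule_mul _ _)

theorem MvPolynomial.IsHomogeneous.exists_eq_mul_of_dvd {σ R : Type*} [CommSemiring R]
    {a f : MvPolynomial σ R} {m n : ℕ} (ha : a.IsHomogeneous m) (hf : f.IsHomogeneous (m + n))
    (h : a ∣ f) : ∃ g : MvPolynomial σ R, g.IsHomogeneous n ∧ f = a * g := by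
  obtain ⟨g, rfl⟩ := h
  let _ : GradedAlgebra (homogeneousSubmodule σ R) := gradedAlgebra
  refine ⟨DirectSum.decompose (homogeneousSubmodule σ R) g n, ?_, ?_⟩
  · exact SetLike.coe_mem (DirectSum.decompose (homogeneousSubmodule σ R) g n)
  · rw [← DirectSum.coe_decompose_mul_add_of_left_mem (homogeneousSubmodule σ R) ha,
      DirectSum.decompose_of_mem_same (homogeneousSubmodule σ R) hf]

theorem isHomogeneous_lform (α β : K) : (lform α β).IsHomogeneous 1 :=
  (isHomogeneous_C_mul_X β 0).sub (isHomogeneous_C_mul_X α 1)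

theorem isHomogeneous_lform_pow (α β : K) (e : ℕ) : (lform α β ^ e).IsHomogeneous e := by
  simpa using (isHomogeneous_lform α β).pow e

theorem lform_ne_zero {α β : K} (hQ : (α, β) ≠ ((0 : K), (0 : K))) : lform α β ≠ 0 := by
  intro h
  have h₀ := congrArg (eval ![1, 0]) h
  have h₁ := congrArg (eval ![0, 1]) h
  simp [lform] at h₀ h₁
  exact hQ (by rw [h₀, h₁])

theorem le_of_lform_pow_dvd {α β : K} {f : MvPolynomial (Fin 2) K} {e n : ℕ}
    (hf : f.IsHomogeneous n) (hf₀ : f ≠ 0) (h : lform α β ^ e ∣ f) : e ≤ n := by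
  have hdeg := totalDegree_le_of_dvd_of_isDomain h hf₀
  rwa [hf.totalDegree hf₀, (isHomogeneous_lform_pow α β e).totalDegree
    (ne_zero_of_dvd_ne_zero hf₀ h)] at hdeg

theorem exists_lform_pow_dvd_and_not_dvd {α β : K} {f : MvPolynomial (Fin 2) K} {a n : ℕ}
    (hf : f.IsHomogeneous n) (hf₀ : f ≠ 0) (h : lform α β ^ a ∣ f) :
    ∃ e, a ≤ e ∧ lform α β ^ e ∣ f ∧ ¬ lform α β ^ (e + 1) ∣ f := by
  classical
  have ha := le_of_lform_pow_dvd hf hf₀ h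
  refine ⟨Nat.findGreatest (fun e => lform α β ^ e ∣ f) n, Nat.le_findGreatest ha h,
    Nat.findGreatest_spec (P := fun e => lform α β ^ e ∣ f) ha h, fun hsucc => ?_⟩
  have := Nat.le_findGreatest (P := fun e => lform α β ^ e ∣ f)
    (le_of_lform_pow_dvd hf hf₀ hsucc) hsucc
  omega

section

variable {d : ℕ} {L : Submodule K (MvPolynomial (Fin 2) K)} {α β : K}

theorem pow_le_homogeneousSubmodule (hL : L ≤ homogeneousSubmodule (Fin 2) K d) (k : ℕ) :
    L ^ k ≤ homogeneousSubmodule (Fin 2) K (d * k) :=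
  (pow_le_pow_left' hL k).trans (homogeneousSubmodule_pow_le _ _ _ _)

theorem curveValueSemigroup_bounds (hL : L ≤ homogeneousSubmodule (Fin 2) K d)
    {p : ℤ × ℤ} (hp : p ∈ curveValueSemigroup L α β) : 0 ≤ p.2 ∧ p.2 ≤ d * p.1 := by
  induction hp using AddSubmonoid.closure_induction with
  | mem p hp =>
    obtain ⟨k, e, f, hf, hf₀, he, -, rfl⟩ := hp
    have := le_of_lform_pow_dvd (pow_le_homogeneousSubmodule hL k hf) hf₀ he
    exact ⟨by simp, by dsimp only; exact_mod_cast this⟩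
  | zero => simp
  | add p q _ _ hp hq =>
    simp only [Prod.fst_add, Prod.snd_add, mul_add]
    omega

/-- If no power of the linear form lies in the corresponding power of `L`, the value semigroup
avoids the ray `e = d * k` except at the origin. -/
theorem curveValueSemigroup_lt (hL : L ≤ homogeneousSubmodule (Fin 2) K d)
    (h : ∀ k : ℕ, 0 < k → lform α β ^ (d * k) ∉ L ^ k)
    {p : ℤ × ℤ} (hp : p ∈ curveValueSemigroup L α β) :
    0 ≤ p.1 ∧ p.2 ≤ d * p.1 ∧ (p.1 = 0 ∨ p.2 < d * p.1) := by
  induction hp using AddSubmonoid.closure_induction with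
  | mem p hp =>
    obtain ⟨k, e, f, hf, hf₀, he, -, rfl⟩ := hp
    have hfh := pow_le_homogeneousSubmodule hL k hf
    have hle := le_of_lform_pow_dvd hfh hf₀ he
    refine ⟨by simp, by dsimp only; exact_mod_cast hle, ?_⟩
    rcases k.eq_zero_or_pos with rfl | hk
    · simp
    refine Or.inr ?_
    suffices e < d * k by dsimp only; exact_mod_cast this
    refine lt_of_le_of_ne hle ?_
    rintro rfl
    obtain ⟨g, hg, rfl⟩ :=
      (isHomogeneous_lform_pow α β (d * k)).exists_eq_mul_of_dvd (n := 0) hfh he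
    obtain ⟨c, rfl⟩ : ∃ c, g = C c :=
      ⟨_, totalDegree_eq_zero_iff_eq_C.mp (Nat.le_zero.mp hg.totalDegree_le)⟩
    have hc : c ≠ 0 := by
      rintro rfl
      simp at hf₀
    apply h k hk
    rw [mul_comm, ← smul_eq_C_mul] at hf
    exact (Submodule.smul_mem_iff _ hc).mp hf
  | zero => simp
  | add p q _ _ hp hq =>
    simp only [Prod.fst_add, Prod.snd_add, mul_add]
    omega

theorem exists_mem_not_lform_dvd (hd : 1 ≤ d) (hL : L ≤ homogeneousSubmodule (Fin 2) K d)
    (hdeg : ∃ c : ℤ, ∀ᶠ k : ℕ in atTop, (Module.finrank K ↥(L ^ k) : ℤ) = d * k + c) :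
    ∃ f ∈ L, ¬ lform α β ∣ f := by
  by_contra! hdvd
  obtain ⟨n, rfl⟩ := Nat.exists_eq_add_of_le hd
  have hLmul : L ≤ Submodule.span K {lform α β} * homogeneousSubmodule (Fin 2) K n := by
    intro f hf
    obtain ⟨g, hg, rfl⟩ := (isHomogeneous_lform α β).exists_eq_mul_of_dvd (hL hf) (hdvd f hf)
    exact Submodule.mul_mem_mul (Submodule.mem_span_singleton_self _) hg
  have hrank (k : ℕ) : Module.finrank K ↥(L ^ k) ≤ n * k + 1 := by
    have hle : L ^ k ≤ (homogeneousSubmodule (Fin 2) K (n * k)).map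
        (LinearMap.mulLeft K (lform α β ^ k)) := by
      refine (pow_le_pow_left' hLmul k).trans ?_
      rw [mul_pow, Submodule.span_pow, Set.singleton_pow]
      refine (mul_le_mul_right (homogeneousSubmodule_pow_le _ _ _ _) _).trans ?_
      intro f hf
      obtain ⟨g, hg, rfl⟩ := Submodule.mem_span_singleton_mul.mp hf
      exact ⟨g, hg, rfl⟩
    rw [← finrank_homogeneousSubmodule_fin_two (K := K) (n * k)]
    exact (Submodule.finrank_mono hle).trans (Submodule.finrank_map_le _ _)
  obtain ⟨c, hc⟩ := hdeg
  obtain ⟨k, hk, hck⟩ := (hc.and (eventually_ge_atTop (c.natAbs + 2))).exists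
  have hk' : (Module.finrank K ↥(L ^ k) : ℤ) ≤ n * k + 1 := by exact_mod_cast hrank k
  rw [hk] at hk'
  push_cast at hk'
  rw [add_mul] at hk'
  omega

/-- A subspace of `Sym^n` of codimension less than `b + 1` contains a nonzero form vanishing to
order at least `n - b` at `Q`. -/
theorem exists_ne_zero_lform_pow_dvd (hQ : (α, β) ≠ ((0 : K), (0 : K))) {a b : ℕ}
    {V : Submodule K (MvPolynomial (Fin 2) K)}
    (hV : V ≤ homogeneousSubmodule (Fin 2) K (a + b)) (h : a < Module.finrank K V) :
    ∃ f ∈ V, f ≠ 0 ∧ lform α β ^ a ∣ f := by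
  let W := (homogeneousSubmodule (Fin 2) K b).map (LinearMap.mulLeft K (lform α β ^ a))
  have hW : W ≤ homogeneousSubmodule (Fin 2) K (a + b) := by
    rintro _ ⟨g, hg, rfl⟩
    exact (isHomogeneous_lform_pow α β a).mul hg
  have hWrank : Module.finrank K W = b + 1 := by
    rw [← finrank_homogeneousSubmodule_fin_two (K := K) b]
    exact (Submodule.equivMapOfInjective _
      (mul_right_injective₀ (pow_ne_zero a (lform_ne_zero hQ))) _).finrank_eq.symm
  have : FiniteDimensional K V := Submodule.finiteDimensional_of_le hV
  have hsup : Module.finrank K ↥(V ⊔ W) ≤ a + b + 1 := by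
    rw [← finrank_homogeneousSubmodule_fin_two (K := K) (a + b)]
    exact Submodule.finrank_mono (sup_le hV hW)
  have hinf := Submodule.finrank_sup_add_finrank_inf_eq V W
  have hne : V ⊓ W ≠ ⊥ := by
    intro hbot
    rw [hbot, finrank_bot] at hinf
    omega
  obtain ⟨f, ⟨hfV, g, -, rfl⟩, hf₀⟩ := Submodule.exists_mem_ne_zero_of_ne_bot hne
  exact ⟨_, hfV, hf₀, dvd_mul_right _ _⟩

theorem curveValueSemigroup_fg_of_lform_pow_mem (hd : 1 ≤ d)
    (hL : L ≤ homogeneousSubmodule (Fin 2) K d)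
    (hdeg : ∃ c : ℤ, ∀ᶠ k : ℕ in atTop, (Module.finrank K ↥(L ^ k) : ℤ) = d * k + c)
    (hQ : (α, β) ≠ ((0 : K), (0 : K))) {m : ℕ} (hm : 0 < m)
    (h : lform α β ^ (d * m) ∈ L ^ m) : (curveValueSemigroup L α β).FG := by
  refine AddSubmonoid.fg_of_mem_boundary_rays hd hm ?_ ?_
    fun p hp => curveValueSemigroup_bounds hL hp
  · obtain ⟨f, hf, hdvd⟩ := exists_mem_not_lform_dvd (α := α) (β := β) hd hL hdeg
    refine AddSubmonoid.subset_closure ⟨1, 0, f, by simpa using hf, ?_, by simp, by simpa, by simp⟩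
    rintro rfl
    simp at hdvd
  · have hne := pow_ne_zero (d * m) (lform_ne_zero hQ)
    refine AddSubmonoid.subset_closure ⟨m, d * m, _, h, hne, dvd_rfl, fun hdvd => ?_, by simp⟩
    have := le_of_lform_pow_dvd (isHomogeneous_lform_pow α β _) hne hdvd
    omega

theorem exists_lform_pow_mem_of_curveValueSemigroup_fg
    (hL : L ≤ homogeneousSubmodule (Fin 2) K d) (hd : 1 ≤ d)
    (hdeg : ∃ c : ℤ, ∀ᶠ k : ℕ in atTop, (Module.finrank K ↥(L ^ k) : ℤ) = d * k + c)
    (hQ : (α, β) ≠ ((0 : K), (0 : K))) (hfg : (curveValueSemigroup L α β).FG) :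
    ∃ k : ℕ, 0 < k ∧ lform α β ^ (d * k) ∈ L ^ k := by
  by_contra! h
  obtain ⟨T, hT⟩ := hfg
  have hslope : ∃ M : ℤ, 0 ≤ M ∧
      ∀ p ∈ curveValueSemigroup L α β, p.1 ≤ M * (d * p.1 - p.2) := by
    obtain ⟨M, hM⟩ := (T.image Prod.fst).bddAbove
    refine ⟨max M 0, le_max_right _ _, fun p hp => ?_⟩
    rw [← hT] at hp
    induction hp using AddSubmonoid.closure_induction with
    | mem p hp =>
      obtain ⟨h₁, h₂, h₃⟩ :=
        curveValueSemigroup_lt hL h (hT ▸ AddSubmonoid.subset_closure hp)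
      have hpM : p.1 ≤ max M 0 :=
        (hM (Finset.mem_coe.mpr (Finset.mem_image_of_mem _ hp))).trans (le_max_left _ _)
      have hM₀ : 0 ≤ max M 0 := le_max_right _ _
      rcases h₃ with h₃ | h₃
      · rw [h₃]
        exact mul_nonneg hM₀ (by rw [h₃] at h₂; linarith)
      · nlinarith
    | zero => simp
    | add p q _ _ hp hq =>
      simp only [Prod.fst_add, Prod.snd_add]
      linarith
  obtain ⟨M, hM₀, hM⟩ := hslope
  obtain ⟨c, hc⟩ := hdeg
  let b := c.natAbs + 1
  obtain ⟨k, hk, hbk, hMk⟩ :=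
    (hc.and ((eventually_ge_atTop b).and (eventually_gt_atTop (M * b).toNat))).exists
  obtain ⟨a, ha⟩ := Nat.exists_eq_add_of_le' (hbk.trans (Nat.le_mul_of_pos_left k hd))
  have haZ : (d : ℤ) * k = a + b := by exact_mod_cast ha
  have hV := pow_le_homogeneousSubmodule hL k
  obtain ⟨f, hf, hf₀, hdvd⟩ := exists_ne_zero_lform_pow_dvd hQ (ha ▸ hV) (a := a) (by omega)
  obtain ⟨e, hae, he, he'⟩ := exists_lform_pow_dvd_and_not_dvd (hV hf) hf₀ hdvd
  have hle := hM (k, e) (AddSubmonoid.subset_closure ⟨k, e, f, hf, hf₀, he, he', rfl⟩)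
  have hbound : M * ((d : ℤ) * k - e) ≤ M * b :=
    mul_le_mul_of_nonneg_left (by omega) hM₀
  dsimp only at hle
  omega

end

/-- **Theorem 4.7.** Let `L ⊆ Sym^d` be a subspace of dimension at least `3` and of degree
`d`. For a point `Q = (α : β)` of `ℙ¹`, the value semigroup `S(L, Q)` is finitely generated
iff there exists `k > 0` such that `(β·s − α·t)^{dk} ∈ L^k`. -/
theorem curveValueSemigroup_fg_iff [IsAlgClosed K] (d : ℕ) (hd : 1 ≤ d)
    (L : Submodule K (MvPolynomial (Fin 2) K))
    (hL : L ≤ MvPolynomial.homogeneousSubmodule (Fin 2) K d)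
    (hdim : 3 ≤ Module.finrank K ↥L)
    -- `L` has degree `d`
    (hdeg : ∃ c : ℤ, ∀ᶠ k : ℕ in atTop, (Module.finrank K ↥(L ^ k) : ℤ) = d * k + c)
    (α β : K) (hQ : (α, β) ≠ ((0 : K), (0 : K))) :
    (curveValueSemigroup L α β).FG ↔
      ∃ k : ℕ, 0 < k ∧ (lform α β) ^ (d * k) ∈ L ^ k := by
  exact ⟨exists_lform_pow_mem_of_curveValueSemigroup_fg hL hd hdeg hQ,
    fun ⟨_, hm, h⟩ => curveValueSemigroup_fg_of_lform_pow_mem hd hL hdeg hQ hm h⟩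

end
end
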